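/- arXiv:1903.00189 — 4 statements merged into one kernel-verified Lean document; each statement's English description precedes it below -/
import Mathlib

section
/- Let ψ belong to the class T_n. Then ψ admits the integral representation ψ(s) = c₀ + c₁·s + ∫_{ℝ₊ⁿ∖{0}} (e^{s·u} − 1) dμ(u) for all s ∈ (−∞,0)ⁿ, where c₀ = lim_{s→−0} ψ(s) ∈ (−∞,0], c₁ = lim_{s→−∞} ∇ψ(s) ∈ ℝ₊ⁿ, and μ is a positive (Radon) measure on ℝ₊ⁿ∖{0} such that for sufficiently small δ > 0 the functions u ↦ u_j are μ-integrable on [0,δ)ⁿ∖{0} for each j = 1,…,n and μ(ℝ₊ⁿ∖[0,δ)ⁿ) < ∞. -/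
open MeasureTheory Filter Set

noncomputable section

/-- The open negative orthant `(-∞,0)^n`. -/
def negOrthant (n : ℕ) : Set (Fin n → ℝ) := {s | ∀ i, s i < 0}

/-- `f` is absolutely monotone on `(-∞,0)^n`: it is `C^∞` there and all its
iterated partial derivatives (of all orders, including order `0`) are nonnegative. -/
def AbsMono (n : ℕ) (f : (Fin n → ℝ) → ℝ) : Prop :=
  ContDiffOn ℝ (⊤ : ℕ∞) f (negOrthant n) ∧
  ∀ (k : ℕ) (m : Fin k → Fin n), ∀ x ∈ negOrthant n,
    0 ≤ iteratedFDerivWithin ℝ k f (negOrthant n) x (fun i => Pi.single (m i) 1)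

/-- `ψ` belongs to the class `T_n`: it is a nonpositive `C^∞` function on `(-∞,0)^n`
all of whose partial derivatives of every order `≥ 1` are nonnegative. -/
def MemT (n : ℕ) (ψ : (Fin n → ℝ) → ℝ) : Prop :=
  ContDiffOn ℝ (⊤ : ℕ∞) ψ (negOrthant n) ∧
  (∀ x ∈ negOrthant n, ψ x ≤ 0) ∧
  ∀ (k : ℕ) (m : Fin (k + 1) → Fin n), ∀ x ∈ negOrthant n,
    0 ≤ iteratedFDerivWithin ℝ (k + 1) ψ (negOrthant n) x (fun i => Pi.single (m i) 1)

/-- `ℝ₊ⁿ ∖ {0}`. -/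
def posPart (n : ℕ) : Set (Fin n → ℝ) := {u | (∀ i, 0 ≤ u i) ∧ u ≠ 0}

/-- `[0,δ)ⁿ ∖ {0}`. -/
def smallBox (n : ℕ) (δ : ℝ) : Set (Fin n → ℝ) := {u | (∀ i, 0 ≤ u i ∧ u i < δ) ∧ u ≠ 0}

/-- `ℝ₊ⁿ ∖ [0,δ)ⁿ`. -/
def farPart (n : ℕ) (δ : ℝ) : Set (Fin n → ℝ) := {u | (∀ i, 0 ≤ u i) ∧ ¬ ∀ i, u i < δ}

/-- The conditions on the representing measure: for sufficiently small `δ > 0`,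
the coordinate functions are integrable on `[0,δ)ⁿ ∖ {0}` and
`μ(ℝ₊ⁿ ∖ [0,δ)ⁿ) < ∞`. -/
def GoodMeasure (n : ℕ) (μ : Measure (Fin n → ℝ)) : Prop :=
  ∃ δ > (0:ℝ), (∀ j, IntegrableOn (fun u => u j) (smallBox n δ) μ) ∧ μ (farPart n δ) < ⊤

/-- The Taylor remainder of order `k` at `0` of a function `g j` belonging to a sequence in which
each function has the next one as its derivative. -/
def taylorRemainder (g : ℕ → ℝ → ℝ) (k j : ℕ) (t : ℝ) : ℝ :=
  g j t - ∑ i ∈ Finset.range k, g (j + i) 0 / (i.factorial : ℝ) * t ^ i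

lemma taylorRemainder_succ_zero (g : ℕ → ℝ → ℝ) (k j : ℕ) :
    taylorRemainder g (k + 1) j 0 = 0 := by
  simp [taylorRemainder, Finset.sum_range_succ']

lemma hasDerivAt_taylorRemainder_succ {g : ℕ → ℝ → ℝ} {t : ℝ} (k j : ℕ)
    (hg : HasDerivAt (g j) (g (j + 1) t) t) :
    HasDerivAt (taylorRemainder g (k + 1) j) (taylorRemainder g k (j + 1) t) t := by
  unfold taylorRemainder
  simp_rw [Finset.sum_range_succ' _ k]
  refine hg.sub ?_
  simp only [pow_zero, mul_one]
  refine HasDerivAt.add_const _ (HasDerivAt.fun_sum fun i _ => ?_)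
  have h := (hasDerivAt_pow (i + 1) t).const_mul (g (j + (i + 1)) 0 / ((i + 1).factorial : ℝ))
  refine h.congr_deriv ?_
  have h1 : ((i.factorial : ℕ) : ℝ) ≠ 0 := by positivity
  have h2 : ((i : ℝ) + 1) ≠ 0 := by positivity
  rw [Nat.factorial_succ, show j + 1 + i = j + (i + 1) by ring]
  push_cast
  field_simp

section AbsolutelyMonotoneSequence

variable {g : ℕ → ℝ → ℝ} {Y : ℝ}

lemma monotoneOn_Icc_of_hasDerivAt {h h' : ℝ → ℝ} (hd : ∀ t ∈ Icc 0 Y, HasDerivAt h (h' t) t)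
    (hn : ∀ t ∈ Icc 0 Y, 0 ≤ h' t) : MonotoneOn h (Icc 0 Y) := by
  refine monotoneOn_of_hasDerivWithinAt_nonneg (convex_Icc 0 Y)
    (fun t ht => (hd t ht).continuousAt.continuousWithinAt)
    (fun t ht => (hd t (interior_subset ht)).hasDerivWithinAt)
    (fun t ht => hn t (interior_subset ht))

lemma taylorRemainder_nonneg (hd : ∀ j, ∀ t ∈ Icc 0 Y, HasDerivAt (g j) (g (j + 1) t) t)
    (hn : ∀ j, ∀ t ∈ Icc 0 Y, 0 ≤ g j t) (k : ℕ) :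
    ∀ j, ∀ t ∈ Icc 0 Y, 0 ≤ taylorRemainder g k j t := by
  induction k with
  | zero => intro j t ht; simpa [taylorRemainder] using hn j t ht
  | succ k ih =>
    intro j t ht
    have := monotoneOn_Icc_of_hasDerivAt
      (fun t ht => hasDerivAt_taylorRemainder_succ k j (hd j t ht)) (ih (j + 1))
      (left_mem_Icc.2 (ht.1.trans ht.2)) ht ht.1
    rwa [taylorRemainder_succ_zero] at this

lemma taylorRemainder_mul_le (hd : ∀ j, ∀ t ∈ Icc 0 Y, HasDerivAt (g j) (g (j + 1) t) t)
    (hn : ∀ j, ∀ t ∈ Icc 0 Y, 0 ≤ g j t) {c : ℝ} (hc : c ∈ Icc (0 : ℝ) 1) (k : ℕ) :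
    ∀ j, ∀ t ∈ Icc 0 Y, taylorRemainder g k j (c * t) ≤ c ^ k * taylorRemainder g k j t := by
  have hmem : ∀ t ∈ Icc 0 Y, c * t ∈ Icc 0 Y := fun t ht =>
    ⟨mul_nonneg hc.1 ht.1, (mul_le_of_le_one_left ht.1 hc.2).trans ht.2⟩
  induction k with
  | zero =>
    intro j t ht
    simpa [taylorRemainder] using monotoneOn_Icc_of_hasDerivAt (hd j) (hn (j + 1)) (hmem t ht) ht
      (mul_le_of_le_one_left ht.1 hc.2)
  | succ k ih =>
    intro j t ht
    have hder : ∀ t ∈ Icc 0 Y, HasDerivAt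
        (fun t => c ^ (k + 1) * taylorRemainder g (k + 1) j t - taylorRemainder g (k + 1) j (c * t))
        (c ^ (k + 1) * taylorRemainder g k (j + 1) t - taylorRemainder g k (j + 1) (c * t) * c) t := by
      intro t ht
      refine ((hasDerivAt_taylorRemainder_succ k j (hd j t ht)).const_mul _).sub ?_
      have h1 := hasDerivAt_taylorRemainder_succ k j (hd j _ (hmem t ht))
      have h2 : HasDerivAt (fun t => c * t) c t := by simpa using (hasDerivAt_id t).const_mul c
      exact h1.comp t h2
    have := monotoneOn_Icc_of_hasDerivAt hder
      (fun t ht => by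
        have := mul_le_mul_of_nonneg_right (ih (j + 1) t ht) hc.1
        rw [pow_succ]
        linarith)
      (left_mem_Icc.2 (ht.1.trans ht.2)) ht ht.1
    simpa [taylorRemainder_succ_zero] using this

/-- Bernstein's theorem: the Taylor series at `0` of an absolutely monotone function on `[0, Y]`
converges to it on `[0, Y)`. -/
lemma hasSum_taylor_of_nonneg (hd : ∀ j, ∀ t ∈ Icc 0 Y, HasDerivAt (g j) (g (j + 1) t) t)
    (hn : ∀ j, ∀ t ∈ Icc 0 Y, 0 ≤ g j t) {x : ℝ} (hx : 0 ≤ x) (hxY : x < Y) :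
    HasSum (fun k => g k 0 / (k.factorial : ℝ) * x ^ k) (g 0 x) := by
  have hY : 0 < Y := hx.trans_lt hxY
  have hYm : Y ∈ Icc 0 Y := right_mem_Icc.2 hY.le
  have h0m : (0 : ℝ) ∈ Icc 0 Y := left_mem_Icc.2 hY.le
  rw [hasSum_iff_tendsto_nat_of_nonneg
    (fun k => mul_nonneg (div_nonneg (hn k 0 h0m) (by positivity)) (by positivity))]
  have hR : Tendsto (fun k => taylorRemainder g k 0 x) atTop (nhds 0) := by
    have hq : Tendsto (fun k => (x / Y) ^ k * g 0 Y) atTop (nhds 0) := by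
      simpa using (tendsto_pow_atTop_nhds_zero_of_lt_one (by positivity)
        ((div_lt_one hY).2 hxY)).mul_const (g 0 Y)
    refine squeeze_zero (fun k => taylorRemainder_nonneg hd hn k 0 x ⟨hx, hxY.le⟩) (fun k => ?_) hq
    have h1 := taylorRemainder_mul_le hd hn (c := x / Y)
      ⟨by positivity, ((div_lt_one hY).2 hxY).le⟩ k 0 Y hYm
    rw [div_mul_cancel₀ _ hY.ne'] at h1
    refine h1.trans (mul_le_mul_of_nonneg_left ?_ (by positivity))
    refine sub_le_self _ (Finset.sum_nonneg fun i _ => ?_)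
    exact mul_nonneg (div_nonneg (hn _ 0 h0m) (by positivity)) (by positivity)
  have := (tendsto_const_nhds (x := g 0 x)).sub hR
  simpa [taylorRemainder] using this

end AbsolutelyMonotoneSequence

lemma isOpen_negOrthant (n : ℕ) : IsOpen (negOrthant n) := by
  simp only [negOrthant, ofPred_forall]
  exact isOpen_iInter_of_finite fun i => isOpen_lt (continuous_apply i) continuous_const

lemma convex_negOrthant (n : ℕ) : Convex ℝ (negOrthant n) := by
  have : negOrthant n = Set.univ.pi fun _ => Iio (0 : ℝ) := by ext; simp [negOrthant]
  rw [this]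
  exact convex_pi fun _ _ => convex_Iio 0

lemma hasFDerivAt_iteratedFDeriv_apply {n : ℕ} {f : (Fin n → ℝ) → ℝ}
    (hf : ContDiffOn ℝ (⊤ : ℕ∞) f (negOrthant n)) {x : Fin n → ℝ} (hx : x ∈ negOrthant n) (k : ℕ)
    (v : Fin k → Fin n → ℝ) :
    HasFDerivAt (fun y => iteratedFDeriv ℝ k f y v)
      ((fderiv ℝ (iteratedFDeriv ℝ k f) x).flipMultilinear v) x := by
  have hc : ContDiffAt ℝ (⊤ : ℕ∞) f x := hf.contDiffAt ((isOpen_negOrthant n).mem_nhds hx)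
  have hd : DifferentiableAt ℝ (iteratedFDeriv ℝ k f) x :=
    hc.differentiableAt_iteratedFDeriv (by exact_mod_cast WithTop.coe_lt_top k)
  exact (ContinuousMultilinearMap.apply ℝ (fun _ : Fin k => (Fin n → ℝ)) ℝ v).hasFDerivAt.comp x
    hd.hasFDerivAt

lemma fderiv_iteratedFDeriv_flipMultilinear_apply {n k : ℕ} (f : (Fin n → ℝ) → ℝ) (x : Fin n → ℝ)
    (v : Fin k → Fin n → ℝ) (w : Fin n → ℝ) :
    (fderiv ℝ (iteratedFDeriv ℝ k f) x).flipMultilinear v w =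
      iteratedFDeriv ℝ (k + 1) f x (Fin.cons w v) := by
  rw [iteratedFDeriv_succ_apply_left]
  rfl

lemma monotoneOn_iteratedFDeriv_apply {n : ℕ} {f : (Fin n → ℝ) → ℝ}
    (hf : ContDiffOn ℝ (⊤ : ℕ∞) f (negOrthant n)) (k : ℕ) (v : Fin k → Fin n → ℝ)
    (hn : ∀ x ∈ negOrthant n, ∀ i,
      0 ≤ iteratedFDeriv ℝ (k + 1) f x (Fin.cons (Pi.single i 1) v)) :
    MonotoneOn (fun x => iteratedFDeriv ℝ k f x v) (negOrthant n) := by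
  intro x hx y hy hxy
  obtain ⟨z, hz, hzeq⟩ := domain_mvt
    (fun z hz => (hasFDerivAt_iteratedFDeriv_apply hf hz k v).hasFDerivWithinAt)
    (convex_negOrthant n) hx hy
  have hz' : z ∈ negOrthant n := (convex_negOrthant n).segment_subset hx hy hz
  rw [← sub_nonneg, hzeq, pi_eq_sum_univ' (y - x), map_sum]
  refine Finset.sum_nonneg fun i _ => ?_
  rw [map_smul, smul_eq_mul, fderiv_iteratedFDeriv_flipMultilinear_apply]
  exact mul_nonneg (sub_nonneg.2 (hxy i)) (hn z hz' i)

/-- The index set of the atoms of the measures approximating the representing measure: finite words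
in the alphabet `Fin n`. -/
abbrev Word (n : ℕ) : Type := Σ k : ℕ, Fin k → Fin n

/-- The weight of the atom indexed by a word, built from the Taylor coefficient at `(-N, …, -N)`. -/
def atomWeight {n : ℕ} (f : (Fin n → ℝ) → ℝ) (N : ℝ) (w : Word n) : ℝ :=
  N ^ w.1 / (w.1.factorial : ℝ) *
    iteratedFDeriv ℝ w.1 f (fun _ => -N) (fun i => Pi.single (w.2 i) 1)

/-- The position of the atom indexed by a word. -/
def atomPos {n : ℕ} (N : ℝ) (w : Word n) : Fin n → ℝ :=
  N⁻¹ • ∑ i, Pi.single (w.2 i) 1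

lemma atomPos_nonneg {n : ℕ} {N : ℝ} (hN : 0 < N) (w : Word n) : 0 ≤ atomPos N w :=
  smul_nonneg (by positivity) (Finset.sum_nonneg fun i _ => Pi.single_nonneg.2 zero_le_one)

lemma sum_mul_atomPos {n : ℕ} (N : ℝ) (w : Word n) (s : Fin n → ℝ) :
    ∑ i, s i * atomPos N w i = ∑ i, s (w.2 i) / N := by
  simp only [atomPos, Pi.smul_apply, Finset.sum_apply, smul_eq_mul, Finset.mul_sum]
  rw [Finset.sum_comm]
  refine Finset.sum_congr rfl fun i _ => ?_
  rw [Finset.sum_eq_single (w.2 i)]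
  · simp [div_eq_mul_inv]
  · intro b _ hb; simp [hb]
  · simp

section Bernstein

variable {n : ℕ} {f : (Fin n → ℝ) → ℝ}

lemma atomWeight_nonneg
    (hn : ∀ (k : ℕ) (m : Fin k → Fin n), ∀ x ∈ negOrthant n,
      0 ≤ iteratedFDeriv ℝ k f x (fun i => Pi.single (m i) 1)) {N : ℝ} (hN : 0 < N) (w : Word n) :
    0 ≤ atomWeight f N w :=
  mul_nonneg (by positivity) (hn _ _ _ fun _ => neg_neg_of_pos hN)

lemma iteratedFDeriv_apply_eq_sum (k : ℕ) (x v : Fin n → ℝ) :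
    iteratedFDeriv ℝ k f x (fun _ => v) = ∑ m : Fin k → Fin n,
      (∏ i, v (m i)) * iteratedFDeriv ℝ k f x (fun i => Pi.single (m i) 1) := by
  have hv : v = ∑ j, v j • (Pi.single j 1 : Fin n → ℝ) := pi_eq_sum_univ' v
  conv_lhs => rw [hv]
  rw [ContinuousMultilinearMap.map_sum]
  refine Finset.sum_congr rfl fun m _ => ?_
  rw [ContinuousMultilinearMap.map_smul_univ, smul_eq_mul]

lemma hasSum_atomWeight_mul_exp (hf : ContDiffOn ℝ (⊤ : ℕ∞) f (negOrthant n))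
    (hn : ∀ (k : ℕ) (m : Fin k → Fin n), ∀ x ∈ negOrthant n,
      0 ≤ iteratedFDeriv ℝ k f x (fun i => Pi.single (m i) 1))
    {N : ℝ} (hN : 0 < N) {s : Fin n → ℝ} (hs : s ∈ negOrthant n) :
    HasSum (fun w => atomWeight f N w * Real.exp (∑ i, s i * atomPos N w i))
      (f fun i => N * (Real.exp (s i / N) - 1)) := by
  set p : Fin n → ℝ := fun _ => -N with hp
  set v : Fin n → ℝ := fun i => N * Real.exp (s i / N) with hv
  have hv0 : ∀ i, 0 ≤ v i := fun i => by positivity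
  have hpv : p + (1 : ℝ) • v ∈ negOrthant n := fun i => by
    have : Real.exp (s i / N) < 1 := Real.exp_lt_one_iff.2 (div_neg_of_neg_of_pos (hs i) hN)
    simp only [hp, hv, one_smul, Pi.add_apply]
    nlinarith
  obtain ⟨Y, hY1, hY⟩ : ∃ Y > (1 : ℝ), p + Y • v ∈ negOrthant n := by
    have hc : ContinuousAt (fun t : ℝ => p + t • v) 1 := by fun_prop
    have := hc.eventually ((isOpen_negOrthant n).mem_nhds hpv)
    obtain ⟨Y, hY, hY'⟩ := ((this.filter_mono nhdsWithin_le_nhds).and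
      (self_mem_nhdsWithin (s := Ioi (1 : ℝ)))).exists
    exact ⟨Y, hY', hY⟩
  have hseg : ∀ t ∈ Icc 0 Y, p + t • v ∈ negOrthant n := fun t ht i => by
    refine lt_of_le_of_lt ?_ (hY i)
    simpa using mul_le_mul_of_nonneg_right ht.2 (hv0 i)
  have htaylor := hasSum_taylor_of_nonneg
    (g := fun j t => iteratedFDeriv ℝ j f (p + t • v) (fun _ => v)) (Y := Y)
    (fun j t ht => by
      have h1 := hasFDerivAt_iteratedFDeriv_apply hf (hseg t ht) j (fun _ => v)
      have h2 : HasDerivAt (fun t : ℝ => p + t • v) v t := by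
        simpa using ((hasDerivAt_id t).smul_const v).const_add p
      have h3 := h1.comp_hasDerivAt t h2
      rw [fderiv_iteratedFDeriv_flipMultilinear_apply] at h3
      refine h3.congr_deriv ?_
      congr 1
      exact funext fun i => Fin.cases rfl (fun _ => rfl) i)
    (fun j t ht => by
      simp only [iteratedFDeriv_apply_eq_sum]
      exact Finset.sum_nonneg fun m _ =>
        mul_nonneg (Finset.prod_nonneg fun i _ => hv0 _) (hn j m _ (hseg t ht)))
    zero_le_one hY1
  have hterm : ∀ k, iteratedFDeriv ℝ k f (p + (0 : ℝ) • v) (fun _ => v) / (k.factorial : ℝ) * 1 ^ k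
      = ∑ m : Fin k → Fin n, atomWeight f N ⟨k, m⟩ *
        Real.exp (∑ i, s i * atomPos N ⟨k, m⟩ i) := fun k => by
    rw [iteratedFDeriv_apply_eq_sum, zero_smul, add_zero, one_pow, mul_one, Finset.sum_div]
    refine Finset.sum_congr rfl fun m _ => ?_
    simp only [atomWeight, sum_mul_atomPos, Real.exp_sum, hv, Finset.prod_mul_distrib,
      Finset.prod_const, Finset.card_univ, Fintype.card_fin]
    ring
  simp only [hterm] at htaylor
  have hval : iteratedFDeriv ℝ 0 f (p + (1 : ℝ) • v) (fun _ => v) =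
      f fun i => N * (Real.exp (s i / N) - 1) := by
    rw [iteratedFDeriv_zero_apply]
    congr 1
    ext i
    simp [hp, hv]
    ring
  rw [hval] at htaylor
  have hnn : ∀ w, 0 ≤ atomWeight f N w * Real.exp (∑ i, s i * atomPos N w i) := fun w =>
    mul_nonneg (atomWeight_nonneg hn hN w) (Real.exp_pos _).le
  refine htaylor.sigma_of_hasSum (fun k => hasSum_fintype _) ?_
  rw [summable_sigma_of_nonneg hnn]
  refine ⟨fun k => Summable.of_finite, ?_⟩
  simpa only [tsum_fintype] using htaylor.summable

end Bernstein

lemma tendsto_neg_one_div_nhdsWithin (n : ℕ) :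
    Tendsto (fun k : ℕ => (fun _ => -(1 / ((k : ℝ) + 1)) : Fin n → ℝ)) atTop
      (nhdsWithin 0 (negOrthant n)) := by
  refine tendsto_nhdsWithin_iff.2 ⟨tendsto_pi_nhds.2 fun _ => ?_, Eventually.of_forall ?_⟩
  · simpa only [neg_zero, Pi.zero_apply] using (tendsto_one_div_add_atTop_nhds_zero_nat (𝕜 := ℝ)).neg
  · intro k i
    have : (0 : ℝ) < 1 / ((k : ℝ) + 1) := by positivity
    exact neg_neg_of_pos this

instance nhdsWithin_zero_negOrthant_neBot (n : ℕ) : (nhdsWithin 0 (negOrthant n)).NeBot :=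
  (tendsto_neg_one_div_nhdsWithin n).neBot

lemma le_of_monotoneOn_of_tendsto_zero {n : ℕ} {f : (Fin n → ℝ) → ℝ} {C : ℝ}
    (hmono : MonotoneOn f (negOrthant n)) (hC : Tendsto f (nhdsWithin 0 (negOrthant n)) (nhds C))
    {s : Fin n → ℝ} (hs : s ∈ negOrthant n) : f s ≤ C := by
  refine ge_of_tendsto hC ?_
  have h1 : ∀ᶠ x in nhdsWithin 0 (negOrthant n), ∀ i, s i < x i :=
    nhdsWithin_le_nhds (eventually_all.2 fun i =>
      (continuous_apply i).continuousAt.eventually (lt_mem_nhds (hs i)))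
  filter_upwards [h1, self_mem_nhdsWithin] with x hx hx'
  exact hmono hs hx' fun i => (hx i).le

lemma ae_nonneg_of_compl_Ici {n : ℕ} {ν : Measure (Fin n → ℝ)} (hν : ν (Ici 0)ᶜ = 0) :
    ∀ᵐ u ∂ν, 0 ≤ u := hν

lemma sum_mul_nonpos {n : ℕ} {s u : Fin n → ℝ} (hs : s ≤ 0) (hu : 0 ≤ u) :
    ∑ i, s i * u i ≤ 0 :=
  Finset.sum_nonpos fun i _ => mul_nonpos_of_nonpos_of_nonneg (hs i) (hu i)

lemma integrable_exp_sum_mul {n : ℕ} {ν : Measure (Fin n → ℝ)} [IsFiniteMeasure ν]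
    (hν : ν (Ici 0)ᶜ = 0) {s : Fin n → ℝ} (hs : s ≤ 0) :
    Integrable (fun u => Real.exp (∑ i, s i * u i)) ν := by
  refine Integrable.of_bound
    (Continuous.aestronglyMeasurable (by fun_prop)) 1 ?_
  filter_upwards [ae_nonneg_of_compl_Ici hν] with u hu
  rw [Real.norm_eq_abs, Real.abs_exp, Real.exp_le_one_iff]
  exact sum_mul_nonpos hs hu

lemma exp_rescale_mem_negOrthant {n : ℕ} {N : ℝ} (hN : 0 < N) {s : Fin n → ℝ}
    (hs : s ∈ negOrthant n) : (fun i => N * (Real.exp (s i / N) - 1)) ∈ negOrthant n := fun i =>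
  mul_neg_of_pos_of_neg hN
    (sub_neg.2 (Real.exp_lt_one_iff.2 (div_neg_of_neg_of_pos (hs i) hN)))

lemma le_exp_rescale {N : ℝ} (hN : 0 < N) (a : ℝ) : a ≤ N * (Real.exp (a / N) - 1) := by
  have h := mul_le_mul_of_nonneg_left (Real.add_one_le_exp (a / N)) hN.le
  have h2 : N * (a / N) = a := mul_div_cancel₀ a hN.ne'
  linarith

lemma tendsto_exp_rescale (a : ℝ) :
    Tendsto (fun k : ℕ => ((k : ℝ) + 1) * (Real.exp (a / ((k : ℝ) + 1)) - 1)) atTop (nhds a) := by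
  rcases eq_or_ne a 0 with rfl | ha
  · simp
  have h1 : Tendsto (fun k : ℕ => a / ((k : ℝ) + 1)) atTop (nhdsWithin 0 {0}ᶜ) := by
    refine tendsto_nhdsWithin_iff.2 ⟨?_, Eventually.of_forall fun k => ?_⟩
    · simpa [div_eq_mul_inv] using tendsto_one_div_add_atTop_nhds_zero_nat.const_mul a
    · have : ((k : ℝ) + 1) ≠ 0 := by positivity
      simp [ha, this]
  have h2 := (Real.hasDerivAt_exp 0).tendsto_slope_zero.comp h1
  have h3 := h2.mul_const a
  simp only [Real.exp_zero, one_mul] at h3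
  refine h3.congr fun k => ?_
  have : ((k : ℝ) + 1) ≠ 0 := by positivity
  simp [div_eq_mul_inv]
  field_simp

section Bernstein

variable {n : ℕ} {f : (Fin n → ℝ) → ℝ} {C : ℝ}

lemma exists_finiteMeasure_integral_exp_eq (hf : ContDiffOn ℝ (⊤ : ℕ∞) f (negOrthant n))
    (hn : ∀ (k : ℕ) (m : Fin k → Fin n), ∀ x ∈ negOrthant n,
      0 ≤ iteratedFDeriv ℝ k f x (fun i => Pi.single (m i) 1))
    (hC : ∀ s ∈ negOrthant n, f s ≤ C) {N : ℝ} (hN : 0 < N) :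
    ∃ ν : FiniteMeasure (Fin n → ℝ), (ν.mass : ℝ) ≤ C ∧ (ν : Measure (Fin n → ℝ)) (Ici 0)ᶜ = 0 ∧
      ∀ s ∈ negOrthant n, ∫ u, Real.exp (∑ i, s i * u i) ∂(ν : Measure (Fin n → ℝ)) =
        f fun i => N * (Real.exp (s i / N) - 1) := by
  have hw := atomWeight_nonneg hn hN
  have hfin : ∀ F : Finset (Word n), ∑ w ∈ F, atomWeight f N w ≤ C := fun F => by
    have hlim : Tendsto (fun s : Fin n → ℝ =>
        ∑ w ∈ F, atomWeight f N w * Real.exp (∑ i, s i * atomPos N w i))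
        (nhdsWithin 0 (negOrthant n)) (nhds (∑ w ∈ F, atomWeight f N w)) := by
      have hcont : Continuous (fun s : Fin n → ℝ =>
        ∑ w ∈ F, atomWeight f N w * Real.exp (∑ i, s i * atomPos N w i)) := by fun_prop
      simpa using (hcont.tendsto 0).mono_left nhdsWithin_le_nhds
    refine le_of_tendsto hlim ?_
    filter_upwards [self_mem_nhdsWithin] with s hs
    exact (sum_le_hasSum F (fun w _ => mul_nonneg (hw w) (Real.exp_pos _).le)
      (hasSum_atomWeight_mul_exp hf hn hN hs)).trans (hC _ (exp_rescale_mem_negOrthant hN hs))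
  have hsum : Summable (atomWeight f N) := summable_of_sum_le hw hfin
  set ν : Measure (Fin n → ℝ) :=
    Measure.sum fun w : Word n => ENNReal.ofReal (atomWeight f N w) • Measure.dirac (atomPos N w)
    with hν
  have huniv : ν univ = ENNReal.ofReal (∑' w, atomWeight f N w) := by
    rw [hν, Measure.sum_apply _ MeasurableSet.univ, ENNReal.ofReal_tsum_of_nonneg hw hsum]
    simp
  have hfinite : IsFiniteMeasure ν := ⟨by rw [huniv]; exact ENNReal.ofReal_lt_top⟩
  have hsupp : ν (Ici 0)ᶜ = 0 := by
    rw [hν, Measure.sum_apply _ measurableSet_Ici.compl]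
    simp [atomPos_nonneg hN]
  refine ⟨⟨ν, hfinite⟩, ?_, hsupp, fun s hs => ?_⟩
  · have : ((FiniteMeasure.mass ⟨ν, hfinite⟩ : NNReal) : ℝ) = (ν univ).toReal := rfl
    rw [this, huniv, ENNReal.toReal_ofReal (tsum_nonneg hw)]
    exact Real.tsum_le_of_sum_le hw hfin
  · have hint := integrable_exp_sum_mul hsupp fun i => (hs i).le
    have h1 := hasSum_integral_measure (hν ▸ hint)
    refine h1.unique ?_
    refine (hasSum_atomWeight_mul_exp hf hn hN hs).congr_fun fun w => ?_
    rw [integral_smul_measure, integral_dirac, ENNReal.toReal_ofReal (hw w), smul_eq_mul]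

/-- The **Bernstein–Widder theorem** for bounded absolutely monotone functions on the negative
orthant: such a function is the Laplace transform of a finite measure. -/
theorem exists_finiteMeasure_eq_integral_exp (hf : ContDiffOn ℝ (⊤ : ℕ∞) f (negOrthant n))
    (hn : ∀ (k : ℕ) (m : Fin k → Fin n), ∀ x ∈ negOrthant n,
      0 ≤ iteratedFDeriv ℝ k f x (fun i => Pi.single (m i) 1))
    (hlim : Tendsto f (nhdsWithin 0 (negOrthant n)) (nhds C)) :
    ∃ ν : FiniteMeasure (Fin n → ℝ), (ν : Measure (Fin n → ℝ)) (Ici 0)ᶜ = 0 ∧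
      ∀ s ∈ negOrthant n, f s = ∫ u, Real.exp (∑ i, s i * u i) ∂(ν : Measure (Fin n → ℝ)) := by
  have hmono : MonotoneOn f (negOrthant n) := by
    refine monotoneOn_iteratedFDeriv_apply hf 0 Fin.elim0 fun x hx i => ?_
    convert hn 1 (fun _ => i) x hx using 2
    exact funext fun j => by rw [Fin.fin_one_eq_zero j]; rfl
  have hC : ∀ s ∈ negOrthant n, f s ≤ C := fun s hs =>
    le_of_monotoneOn_of_tendsto_zero hmono hlim hs
  choose ν hmass hsupp hint using fun k : ℕ =>
    exists_finiteMeasure_integral_exp_eq hf hn hC (N := (k : ℝ) + 1) (by positivity)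
  set K : ℕ → Set (Fin n → ℝ) := fun k => Icc 0 (fun _ => (k : ℝ) + 1) with hK
  set d : ℝ := 1 - Real.exp (-1) with hd
  have hd0 : 0 < d := by
    have : Real.exp (-1) < 1 := Real.exp_lt_one_iff.2 (by norm_num)
    linarith
  set b : ℕ → NNReal := fun k => Real.toNNReal ((C - f fun _ => -(1 / ((k : ℝ) + 1))) / d) with hb
  have hb0 : Tendsto b atTop (nhds 0) := by
    have h1 := ((hlim.comp (tendsto_neg_one_div_nhdsWithin n)).const_sub C).div_const d
    rw [sub_self, zero_div] at h1
    have h2 := (continuous_real_toNNReal.tendsto 0).comp h1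
    rwa [Real.toNNReal_zero] at h2
  have htight : ∀ j k, ν j (K k)ᶜ ≤ b k := fun j k => by
    set s : Fin n → ℝ := fun _ => -(1 / ((k : ℝ) + 1)) with hs
    have hsn : s ∈ negOrthant n := fun i => by simp only [hs, neg_lt_zero]; positivity
    have hnn : ∀ᵐ u ∂(ν j : Measure (Fin n → ℝ)), 0 ≤ u := ae_nonneg_of_compl_Ici (hsupp j)
    have hi := integrable_exp_sum_mul (hsupp j) fun i => (hsn i).le
    have hmarkov := mul_meas_ge_le_integral_of_nonneg
      (μ := (ν j : Measure (Fin n → ℝ))) (f := fun u => 1 - Real.exp (∑ i, s i * u i))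
      (by
        filter_upwards [hnn] with u hu
        simpa using sum_mul_nonpos (fun i => (hsn i).le) hu)
      ((integrable_const 1).sub hi) d
    rw [integral_sub (integrable_const 1) hi, hint j s hsn] at hmarkov
    have hsub : (ν j : Measure (Fin n → ℝ)).real (K k)ᶜ ≤
        (ν j : Measure (Fin n → ℝ)).real {u | d ≤ 1 - Real.exp (∑ i, s i * u i)} := by
      refine ENNReal.toReal_mono (measure_ne_top _ _) (measure_mono_ae ?_)
      filter_upwards [hnn] with u hu huK
      have huK' : ∃ i, (k : ℝ) + 1 < u i := by
        by_contra! h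
        exact huK ⟨hu, h⟩
      obtain ⟨i, hi⟩ := huK'
      have hk : (0 : ℝ) < (k : ℝ) + 1 := by positivity
      have h1 : ∑ i, s i * u i ≤ -1 := by
        rw [← Finset.add_sum_erase _ _ (Finset.mem_univ i)]
        have h2 : ∑ j ∈ Finset.univ.erase i, s j * u j ≤ 0 :=
          Finset.sum_nonpos fun j _ => mul_nonpos_of_nonpos_of_nonneg (hsn j).le (hu j)
        have h3 : 1 ≤ 1 / ((k : ℝ) + 1) * u i := by
          rw [one_div_mul_eq_div, le_div_iff₀ hk]; linarith
        have h4 : s i * u i = -(1 / ((k : ℝ) + 1) * u i) := by simp only [hs]; ring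
        linarith
      change d ≤ 1 - Real.exp (∑ i, s i * u i)
      have := Real.exp_le_exp.2 h1
      linarith
    have hmono' : f s ≤ f fun i => ((j : ℝ) + 1) * (Real.exp (s i / ((j : ℝ) + 1)) - 1) :=
      hmono hsn (exp_rescale_mem_negOrthant (by positivity) hsn)
        fun i => le_exp_rescale (by positivity) _
    have hm : ∫ _, (1 : ℝ) ∂(ν j : Measure (Fin n → ℝ)) = (ν j).mass := by simp
    rw [hm] at hmarkov
    have hle : ((ν j (K k)ᶜ : NNReal) : ℝ) ≤ (C - f s) / d := by
      rw [le_div_iff₀ hd0]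
      have h5 : ((ν j (K k)ᶜ : NNReal) : ℝ) = (ν j : Measure (Fin n → ℝ)).real (K k)ᶜ := rfl
      rw [h5]
      have := hmass j
      nlinarith [mul_le_mul_of_nonneg_left hsub hd0.le]
    exact (Real.le_toNNReal_iff_coe_le ((NNReal.coe_nonneg _).trans hle)).2 hle
  have hcompact := isCompact_setOfPred_finiteMeasure_mass_le_compl_isCompact_le (E := Fin n → ℝ)
    (u := b) (K := K) (Real.toNNReal C) hb0 (fun k => isCompact_Icc) (Or.inl inferInstance)
  have hmem : ∀ j, ν j ∈ {μ : FiniteMeasure (Fin n → ℝ) |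
      μ.mass ≤ Real.toNNReal C ∧ ∀ k, μ (K k)ᶜ ≤ b k} := fun j =>
    ⟨(Real.le_toNNReal_iff_coe_le ((NNReal.coe_nonneg _).trans (hmass j))).2 (hmass j), htight j⟩
  obtain ⟨ρ, ⟨-, hρK⟩, hρ⟩ := isCompact_iff_ultrafilter_le_nhds.1 hcompact
    ((hyperfilter ℕ).map ν) (le_principal_iff.2 (mem_map.2 (univ_mem' hmem)))
  have hρ' : Tendsto ν (hyperfilter ℕ : Filter ℕ) (nhds ρ) := hρ
  have hρsupp : (ρ : Measure (Fin n → ℝ)) (Ici 0)ᶜ = 0 := by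
    have h1 : ρ (Ici 0)ᶜ = 0 := by
      refine le_antisymm (ge_of_tendsto' hb0 fun k => ?_) bot_le
      exact (FiniteMeasure.apply_mono ρ (compl_subset_compl.2 Icc_subset_Ici_self)).trans (hρK k)
    exact (FiniteMeasure.null_iff_toMeasure_null ρ _).1 h1
  refine ⟨ρ, hρsupp, fun s hs => ?_⟩
  let g : BoundedContinuousFunction (Fin n → ℝ) ℝ :=
    BoundedContinuousFunction.ofNormedAddCommGroup
      (fun u => Real.exp (∑ i, s i * max (u i) 0)) (by fun_prop) 1 fun u => by
        rw [Real.norm_eq_abs, Real.abs_exp, Real.exp_le_one_iff]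
        exact sum_mul_nonpos (fun i => (hs i).le) (fun i => le_max_right _ _)
  have hg : ∀ μ : FiniteMeasure (Fin n → ℝ), (μ : Measure (Fin n → ℝ)) (Ici 0)ᶜ = 0 →
      ∫ u, g u ∂(μ : Measure (Fin n → ℝ)) =
        ∫ u, Real.exp (∑ i, s i * u i) ∂(μ : Measure (Fin n → ℝ)) := fun μ hμ => by
    refine integral_congr_ae ?_
    filter_upwards [ae_nonneg_of_compl_Ici hμ] with u hu
    change Real.exp (∑ i, s i * max (u i) 0) = _
    have hu' : ∀ i, max (u i) 0 = u i := fun i => max_eq_left (hu i)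
    simp only [hu']
  have h1 := FiniteMeasure.tendsto_iff_forall_integral_tendsto.1 hρ' g
  simp only [hg _ hρsupp, hg _ (hsupp _), hint _ s hs] at h1
  have h2 : Tendsto (fun k : ℕ => f fun i =>
      ((k : ℝ) + 1) * (Real.exp (s i / ((k : ℝ) + 1)) - 1)) atTop (nhds (f s)) :=
    (hf.continuousOn.continuousAt ((isOpen_negOrthant n).mem_nhds hs)).tendsto.comp
      (tendsto_pi_nhds.2 fun i => tendsto_exp_rescale (s i))
  exact tendsto_nhds_unique (h2.mono_left Nat.hyperfilter_le_atTop) h1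

end Bernstein

lemma neg_one_mem_negOrthant (n : ℕ) : (fun _ => -1) ∈ negOrthant n := fun _ => by norm_num

lemma exists_tendsto_nhdsWithin_zero_of_monotoneOn {n : ℕ} {f : (Fin n → ℝ) → ℝ} {B : ℝ}
    (hmono : MonotoneOn f (negOrthant n)) (hB : ∀ s ∈ negOrthant n, f s ≤ B) :
    ∃ c ≤ B, Tendsto f (nhdsWithin 0 (negOrthant n)) (nhds c) := by
  have hne : (f '' negOrthant n).Nonempty := ⟨_, mem_image_of_mem f (neg_one_mem_negOrthant n)⟩
  have hbdd : BddAbove (f '' negOrthant n) := ⟨B, forall_mem_image.2 hB⟩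
  refine ⟨sSup (f '' negOrthant n), csSup_le hne (forall_mem_image.2 hB),
    tendsto_order.2 ⟨fun a ha => ?_, fun a ha => ?_⟩⟩
  · obtain ⟨_, ⟨s, hs, rfl⟩, has⟩ := exists_lt_of_lt_csSup hne ha
    have h1 : ∀ᶠ x in nhdsWithin 0 (negOrthant n), ∀ i, s i < x i :=
      nhdsWithin_le_nhds (eventually_all.2 fun i =>
        (continuous_apply i).continuousAt.eventually (lt_mem_nhds (hs i)))
    filter_upwards [h1, self_mem_nhdsWithin] with x hx hx'
    exact has.trans_le (hmono hs hx' fun i => (hx i).le)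
  · filter_upwards [self_mem_nhdsWithin] with x hx
    exact (le_csSup hbdd (mem_image_of_mem f hx)).trans_lt ha

lemma exists_tendsto_atBot_of_monotoneOn {n : ℕ} {f : (Fin n → ℝ) → ℝ}
    (hmono : MonotoneOn f (negOrthant n)) (hB : ∀ s ∈ negOrthant n, 0 ≤ f s) :
    ∃ c, 0 ≤ c ∧ Tendsto f atBot (nhds c) := by
  have hne : (f '' negOrthant n).Nonempty := ⟨_, mem_image_of_mem f (neg_one_mem_negOrthant n)⟩
  have hbdd : BddBelow (f '' negOrthant n) := ⟨0, forall_mem_image.2 hB⟩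
  have hmem : ∀ {s x}, s ∈ negOrthant n → x ≤ s → x ∈ negOrthant n :=
    fun hs hx i => (hx i).trans_lt (hs i)
  refine ⟨sInf (f '' negOrthant n), le_csInf hne (forall_mem_image.2 hB),
    tendsto_order.2 ⟨fun a ha => ?_, fun a ha => ?_⟩⟩
  · filter_upwards [eventually_le_atBot (fun _ => -1 : Fin n → ℝ)] with x hx
    exact ha.trans_le
      (csInf_le hbdd (mem_image_of_mem f (hmem (neg_one_mem_negOrthant n) hx)))
  · obtain ⟨_, ⟨s, hs, rfl⟩, has⟩ := exists_lt_of_csInf_lt hne ha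
    filter_upwards [eventually_le_atBot s] with x hx
    exact (hmono (hmem hs hx) hs hx).trans_lt has

lemma tendsto_sub_natCast_atBot {n : ℕ} (s : Fin n → ℝ) :
    Tendsto (fun (M : ℕ) i => s i - (M : ℝ)) atTop atBot := by
  rw [tendsto_atBot]
  intro b
  refine (eventually_all.2 fun i => ?_).mono fun M hM => hM
  have := tendsto_natCast_atTop_atTop (R := ℝ)
  filter_upwards [this.eventually_ge_atTop (s i - b i)] with M hM
  linarith

lemma tendsto_sub_of_tendsto_partialDeriv {n : ℕ} {ψ : (Fin n → ℝ) → ℝ} {c : Fin n → ℝ}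
    (hψ : ContDiffOn ℝ (⊤ : ℕ∞) ψ (negOrthant n))
    (hmono : ∀ j, MonotoneOn (fun s => fderiv ℝ ψ s (Pi.single j 1)) (negOrthant n))
    (hc : ∀ j, Tendsto (fun s => fderiv ℝ ψ s (Pi.single j 1)) atBot (nhds (c j)))
    {s : Fin n → ℝ} (hs : s ∈ negOrthant n) :
    Tendsto (fun M : ℕ => ψ (fun _ => -(M : ℝ)) - ψ (fun i => s i - M)) atTop
      (nhds (-∑ j, c j * s j)) := by
  have hlow : Tendsto (fun (M : ℕ) => ∑ j, fderiv ℝ ψ (fun i => s i - (M : ℝ)) (Pi.single j 1) *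
      -s j) atTop (nhds (-∑ j, c j * s j)) := by
    simp only [← Finset.sum_neg_distrib, ← mul_neg]
    exact tendsto_finsetSum _ fun j _ => ((hc j).comp (tendsto_sub_natCast_atBot s)).mul_const _
  have hup : Tendsto (fun (M : ℕ) => ∑ j, fderiv ℝ ψ (fun _ => -(M : ℝ)) (Pi.single j 1) *
      -s j) atTop (nhds (-∑ j, c j * s j)) := by
    simp only [← Finset.sum_neg_distrib, ← mul_neg]
    have := tendsto_sub_natCast_atBot (0 : Fin n → ℝ)
    simp only [Pi.zero_apply, zero_sub] at this
    exact tendsto_finsetSum _ fun j _ => ((hc j).comp this).mul_const _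
  have hmvt : ∀ᶠ M : ℕ in atTop, ∃ z ∈ negOrthant n, (fun i => s i - (M : ℝ)) ∈ negOrthant n ∧
      (fun _ => -(M : ℝ)) ∈ negOrthant n ∧ (fun i => s i - (M : ℝ)) ≤ z ∧ z ≤ (fun _ => -(M : ℝ)) ∧
      ψ (fun _ => -(M : ℝ)) - ψ (fun i => s i - M) =
        ∑ j, fderiv ℝ ψ z (Pi.single j 1) * -s j := by
    filter_upwards [eventually_ge_atTop 1] with M hM
    have hM' : (1 : ℝ) ≤ M := by exact_mod_cast hM
    have hx : (fun i => s i - (M : ℝ)) ∈ negOrthant n := fun i => by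
      have := hs i
      change s i - (M : ℝ) < 0
      linarith
    have hy : (fun _ => -(M : ℝ)) ∈ negOrthant n := fun i => by linarith
    have hxy : (fun i => s i - (M : ℝ)) ≤ (fun _ => -(M : ℝ)) := fun i => by
      have := hs i
      change s i - (M : ℝ) ≤ -M
      linarith
    obtain ⟨z, hz, hzeq⟩ := domain_mvt (f' := fderiv ℝ ψ)
      (fun z hz => (((hψ.contDiffAt ((isOpen_negOrthant n).mem_nhds hz)).differentiableAt
        (by simp)).hasFDerivAt).hasFDerivWithinAt) (convex_negOrthant n) hx hy
    have hzI := segment_subset_Icc hxy hz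
    refine ⟨z, (convex_negOrthant n).segment_subset hx hy hz, hx, hy, hzI.1, hzI.2, ?_⟩
    rw [hzeq, pi_eq_sum_univ' ((fun _ => -(M : ℝ)) - fun i => s i - (M : ℝ)), map_sum]
    refine Finset.sum_congr rfl fun j _ => ?_
    rw [map_smul, smul_eq_mul, mul_comm]
    congr 1
    simp only [Pi.sub_apply]
    ring
  refine tendsto_of_tendsto_of_tendsto_of_le_of_le' hlow hup ?_ ?_
  · filter_upwards [hmvt] with M ⟨z, hz, hx, hy, hxz, hzy, heq⟩
    rw [heq]
    exact Finset.sum_le_sum fun j _ =>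
      mul_le_mul_of_nonneg_right (hmono j hx hz hxz) (neg_nonneg.2 (hs j).le)
  · filter_upwards [hmvt] with M ⟨z, hz, hx, hy, hxz, hzy, heq⟩
    rw [heq]
    exact Finset.sum_le_sum fun j _ =>
      mul_le_mul_of_nonneg_right (hmono j hz hy hzy) (neg_nonneg.2 (hs j).le)

section LevyKernel

variable {n : ℕ} {u : Fin n → ℝ}

lemma one_sub_exp_neg_sum_nonneg (hu : 0 ≤ u) : 0 ≤ 1 - Real.exp (-∑ i, u i) := by
  rw [sub_nonneg, Real.exp_le_one_iff, neg_nonpos]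
  exact Finset.sum_nonneg fun i _ => hu i

lemma one_sub_exp_neg_sum_pos (hu : u ∈ posPart n) : 0 < 1 - Real.exp (-∑ i, u i) := by
  rw [sub_pos, Real.exp_lt_one_iff, neg_lt_zero]
  obtain ⟨i, hi⟩ := Function.ne_iff.1 hu.2
  exact Finset.sum_pos' (fun i _ => hu.1 i) ⟨i, Finset.mem_univ i, lt_of_le_of_ne (hu.1 i) hi.symm⟩

lemma one_sub_exp_le_mul {s : Fin n → ℝ} {K : ℕ} (hK : ∀ i, -s i ≤ K) (hu : 0 ≤ u) :
    1 - Real.exp (∑ i, s i * u i) ≤ K * (1 - Real.exp (-∑ i, u i)) := by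
  have h1 : Real.exp (-∑ i, u i) ^ K ≤ Real.exp (∑ i, s i * u i) := by
    rw [← Real.exp_nat_mul, Real.exp_le_exp, mul_neg, Finset.mul_sum, ← Finset.sum_neg_distrib]
    refine Finset.sum_le_sum fun i _ => ?_
    have := mul_le_mul_of_nonneg_right (hK i) (hu i)
    linarith
  have h2 := one_add_mul_le_pow (a := Real.exp (-∑ i, u i) - 1)
    (by linarith [Real.exp_pos (-∑ i, u i)]) K
  rw [add_sub_cancel] at h2
  linarith

lemma exists_nat_one_sub_exp_le (s : Fin n → ℝ) : ∃ K : ℕ, ∀ u : Fin n → ℝ, 0 ≤ u →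
    1 - Real.exp (∑ i, s i * u i) ≤ K * (1 - Real.exp (-∑ i, u i)) := by
  obtain ⟨K, hK⟩ := exists_nat_ge (∑ i, |s i|)
  refine ⟨K, fun u hu => one_sub_exp_le_mul (fun i => ?_) hu⟩
  exact (neg_le_abs _).trans ((Finset.single_le_sum (f := fun i => |s i|)
    (fun _ _ => abs_nonneg _) (Finset.mem_univ i)).trans hK)

lemma sum_le_mul_one_sub_exp (hu : 0 ≤ u) :
    ∑ i, u i ≤ (1 + ∑ i, u i) * (1 - Real.exp (-∑ i, u i)) := by
  have h0 : 0 ≤ ∑ i, u i := Finset.sum_nonneg fun i _ => hu i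
  have h1 := Real.add_one_le_exp (∑ i, u i)
  have h2 : Real.exp (∑ i, u i) * Real.exp (-∑ i, u i) = 1 := by
    rw [← Real.exp_add, add_neg_cancel, Real.exp_zero]
  nlinarith [mul_le_mul_of_nonneg_right h1 (Real.exp_pos (-∑ i, u i)).le]

lemma norm_one_sub_exp_div_le {s : Fin n → ℝ} (hs : s ≤ 0) {K : ℕ} (hu : 0 ≤ u)
    (hK : 1 - Real.exp (∑ i, s i * u i) ≤ K * (1 - Real.exp (-∑ i, u i))) :
    ‖(1 - Real.exp (∑ i, s i * u i)) / (1 - Real.exp (-∑ i, u i))‖ ≤ K := by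
  have h1 : 0 ≤ 1 - Real.exp (∑ i, s i * u i) := by simpa using sum_mul_nonpos hs hu
  rw [Real.norm_of_nonneg (div_nonneg h1 (one_sub_exp_neg_sum_nonneg hu))]
  exact div_le_of_le_mul₀ (one_sub_exp_neg_sum_nonneg hu) (Nat.cast_nonneg K) hK

lemma mul_geom_sum_eq {s : Fin n → ℝ} (hu : 0 ≤ u) (M : ℕ) :
    ∑ m ∈ Finset.range M,
      (Real.exp (∑ i, -(m : ℝ) * u i) - Real.exp (∑ i, (s i - m) * u i)) =
    (1 - Real.exp (∑ i, s i * u i)) / (1 - Real.exp (-∑ i, u i)) *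
      (1 - Real.exp (-∑ i, u i) ^ M) := by
  have hterm : ∀ m : ℕ, Real.exp (∑ i, -(m : ℝ) * u i) - Real.exp (∑ i, (s i - m) * u i) =
      (1 - Real.exp (∑ i, s i * u i)) * Real.exp (-∑ i, u i) ^ m := fun m => by
    have h1 : ∑ i, -(m : ℝ) * u i = m * (-∑ i, u i) := by
      rw [← Finset.mul_sum]; ring
    have h2 : ∑ i, (s i - m) * u i = ∑ i, s i * u i + m * (-∑ i, u i) := by
      simp only [sub_mul, Finset.sum_sub_distrib, ← Finset.mul_sum]; ring
    rw [h1, h2, Real.exp_add, Real.exp_nat_mul]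
    ring
  rw [Finset.sum_congr rfl fun m _ => hterm m, ← Finset.mul_sum]
  by_cases hu0 : u = 0
  · simp [hu0]
  · have hp := one_sub_exp_neg_sum_pos (n := n) ⟨hu, hu0⟩
    rw [geom_sum_eq (by linarith), ← neg_sub, ← neg_sub (1 : ℝ) (Real.exp (-∑ i, u i))]
    field_simp
    ring

end LevyKernel

/-- The Lévy–Khintchine representation of `ψ`, obtained from a representation of
`s ↦ ψ s - ψ (s - 1)` by telescoping. -/
lemma integral_one_sub_exp_div_eq {n : ℕ} {ψ : (Fin n → ℝ) → ℝ} {c₀ : ℝ} {c : Fin n → ℝ}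
    {ν : Measure (Fin n → ℝ)} [IsFiniteMeasure ν] (hν : ν (Ici 0)ᶜ = 0)
    (hrep : ∀ s ∈ negOrthant n,
      ψ s - ψ (fun i => s i - 1) = ∫ u, Real.exp (∑ i, s i * u i) ∂ν)
    (hmass : c₀ - ψ (fun _ => -1) = ν.real univ) {s : Fin n → ℝ} (hs : s ∈ negOrthant n)
    (hinc : Tendsto (fun M : ℕ => ψ (fun _ => -(M : ℝ)) - ψ (fun i => s i - M)) atTop
      (nhds (-∑ j, c j * s j))) :
    ∫ u, (1 - Real.exp (∑ i, s i * u i)) / (1 - Real.exp (-∑ i, u i)) ∂ν =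
      c₀ - ψ s + ∑ j, c j * s j := by
  have hnn := ae_nonneg_of_compl_Ici hν
  obtain ⟨K, hK⟩ := exists_nat_one_sub_exp_le s
  have hs0 : s ≤ 0 := fun i => (hs i).le
  set b : ℕ → ℝ := fun m => if m = 0 then c₀ else ψ fun _ => -(m : ℝ) with hb
  have hsm : ∀ m : ℕ, (fun i => s i - (m : ℝ)) ∈ negOrthant n := fun m i => by
    have h1 := hs i
    have h2 : (0 : ℝ) ≤ m := Nat.cast_nonneg m
    change s i - (m : ℝ) < 0
    linarith
  have hI1 : ∀ m : ℕ, Integrable (fun u => Real.exp (∑ i, -(m : ℝ) * u i)) ν := fun m =>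
    integrable_exp_sum_mul hν (s := fun _ => -(m : ℝ)) fun i => by simp
  have hI2 : ∀ m : ℕ, Integrable (fun u => Real.exp (∑ i, (s i - m) * u i)) ν := fun m =>
    integrable_exp_sum_mul hν (s := fun i => s i - (m : ℝ)) fun i => (hsm m i).le
  have hstep : ∀ m : ℕ, ∫ u, (Real.exp (∑ i, -(m : ℝ) * u i) -
      Real.exp (∑ i, (s i - m) * u i)) ∂ν =
      (b m - ψ (fun i => s i - m)) - (b (m + 1) - ψ (fun i => s i - (m + 1 : ℕ))) := fun m => by
    have h2 := hrep _ (hsm m)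
    have h1 : ∫ u, Real.exp (∑ i, -(m : ℝ) * u i) ∂ν = b m - b (m + 1) := by
      rcases Nat.eq_zero_or_pos m with rfl | hm
      · simp [hb, hmass]
      · have h3 := hrep (fun _ => -(m : ℝ)) fun i => by
          have : (0 : ℝ) < m := by exact_mod_cast hm
          linarith
        rw [← h3]
        simp only [hb, hm.ne', if_false, Nat.succ_ne_zero]
        congr 2
        ext i
        push_cast; ring
    rw [integral_sub (hI1 m) (hI2 m), h1, ← h2]
    have h4 : (fun i => s i - ((m + 1 : ℕ) : ℝ)) = fun i => s i - (m : ℝ) - 1 := by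
      ext i; push_cast; ring
    rw [h4]
    ring
  have hpartial : ∀ M : ℕ, ∫ u, (1 - Real.exp (∑ i, s i * u i)) / (1 - Real.exp (-∑ i, u i)) *
      (1 - Real.exp (-∑ i, u i) ^ M) ∂ν = c₀ - ψ s - (b M - ψ (fun i => s i - M)) := fun M => by
    have h1 : ∫ u, (1 - Real.exp (∑ i, s i * u i)) / (1 - Real.exp (-∑ i, u i)) *
        (1 - Real.exp (-∑ i, u i) ^ M) ∂ν = ∫ u, ∑ m ∈ Finset.range M,
        (Real.exp (∑ i, -(m : ℝ) * u i) - Real.exp (∑ i, (s i - m) * u i)) ∂ν := by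
      refine integral_congr_ae ?_
      filter_upwards [hnn] with u hu
      exact (mul_geom_sum_eq hu M).symm
    have h2 := integral_finsetSum (μ := ν) (Finset.range M) (f := fun (m : ℕ) u =>
      Real.exp (∑ i, -(m : ℝ) * u i) - Real.exp (∑ i, (s i - m) * u i))
      fun m _ => (hI1 m).sub (hI2 m)
    rw [h1, h2, Finset.sum_congr rfl fun m _ => hstep m,
      Finset.sum_range_sub' (fun m : ℕ => b m - ψ (fun i => s i - (m : ℝ)))]
    simp [hb]
  have hlim1 : Tendsto (fun M : ℕ => c₀ - ψ s - (b M - ψ (fun i => s i - M))) atTop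
      (nhds (c₀ - ψ s - -∑ j, c j * s j)) := by
    refine tendsto_const_nhds.sub (hinc.congr' ?_)
    filter_upwards [eventually_ge_atTop 1] with M hM
    simp [hb, Nat.one_le_iff_ne_zero.1 hM]
  have hlim2 : Tendsto (fun M : ℕ => ∫ u, (1 - Real.exp (∑ i, s i * u i)) /
      (1 - Real.exp (-∑ i, u i)) * (1 - Real.exp (-∑ i, u i) ^ M) ∂ν) atTop
      (nhds (∫ u, (1 - Real.exp (∑ i, s i * u i)) / (1 - Real.exp (-∑ i, u i)) ∂ν)) := by
    refine tendsto_integral_of_dominated_convergence (fun _ => (K : ℝ))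
      (fun M => Measurable.aestronglyMeasurable (by fun_prop)) (integrable_const _)
      (fun M => ?_) ?_
    · filter_upwards [hnn] with u hu
      rw [norm_mul]
      refine (mul_le_of_le_one_right (norm_nonneg _) ?_).trans
        (norm_one_sub_exp_div_le hs0 hu (hK u hu))
      have h1 : Real.exp (-∑ i, u i) ≤ 1 := sub_nonneg.1 (one_sub_exp_neg_sum_nonneg hu)
      have h2 := pow_le_one₀ (n := M) (Real.exp_pos (-∑ i, u i)).le h1
      have h3 := pow_pos (Real.exp_pos (-∑ i, u i)) M
      rw [Real.norm_of_nonneg (by linarith)]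
      linarith
    · filter_upwards [hnn] with u hu
      by_cases hu0 : u = 0
      · simp [hu0]
      · have hp := one_sub_exp_neg_sum_pos (n := n) ⟨hu, hu0⟩
        have h1 := (tendsto_pow_atTop_nhds_zero_of_lt_one (Real.exp_pos (-∑ i, u i)).le
          (by linarith)).const_sub 1
        simpa using h1.const_mul ((1 - Real.exp (∑ i, s i * u i)) / (1 - Real.exp (-∑ i, u i)))
  simp only [hpartial] at hlim2
  rw [tendsto_nhds_unique hlim2 hlim1]
  ring

lemma measurableSet_posPart (n : ℕ) : MeasurableSet (posPart n) := by
  have h : posPart n = Ici 0 ∩ {0}ᶜ := by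
    ext u
    change ((∀ i, 0 ≤ u i) ∧ u ≠ 0) ↔ _
    simp [Pi.le_def]
  rw [h]
  exact measurableSet_Ici.inter (measurableSet_singleton _).compl

lemma measurableSet_smallBox (n : ℕ) (δ : ℝ) : MeasurableSet (smallBox n δ) := by
  have h : smallBox n δ = (univ.pi fun _ => Ico 0 δ) ∩ {0}ᶜ := by ext u; simp [smallBox]
  rw [h]
  exact (MeasurableSet.univ_pi fun _ => measurableSet_Ico).inter (measurableSet_singleton _).compl

lemma measurableSet_farPart (n : ℕ) (δ : ℝ) : MeasurableSet (farPart n δ) := by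
  have h : farPart n δ = Ici 0 ∩ (univ.pi fun _ => Iio δ)ᶜ := by
    ext u; simp [farPart, Pi.le_def]
  rw [h]
  exact measurableSet_Ici.inter (MeasurableSet.univ_pi fun _ => measurableSet_Iio).compl

/-- The measure on `ℝ₊ⁿ ∖ {0}` with density `(1 - exp (-∑ uᵢ))⁻¹` with respect to `ν`. -/
def levyMeasure {n : ℕ} (ν : Measure (Fin n → ℝ)) : Measure (Fin n → ℝ) :=
  (ν.restrict (posPart n)).withDensity fun u =>
    (Real.toNNReal (1 - Real.exp (-∑ i, u i))⁻¹ : ENNReal)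

section LevyMeasure

variable {n : ℕ} {ν : Measure (Fin n → ℝ)}

lemma measurable_levyDensity :
    Measurable fun u : Fin n → ℝ => Real.toNNReal (1 - Real.exp (-∑ i, u i))⁻¹ := by
  fun_prop

lemma levyMeasure_compl_posPart : levyMeasure ν (posPart n)ᶜ = 0 := by
  refine withDensity_absolutelyContinuous _ _ ?_
  rw [Measure.restrict_apply (measurableSet_posPart n).compl]
  simp

lemma levyMeasure_restrict_posPart : (levyMeasure ν).restrict (posPart n) = levyMeasure ν :=
  Measure.restrict_eq_self_of_ae_mem levyMeasure_compl_posPart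

lemma integrable_levyMeasure [IsFiniteMeasure ν] {h : (Fin n → ℝ) → ℝ} (hm : Measurable h) {B : ℝ}
    (hB : ∀ u ∈ posPart n, |h u| ≤ B * (1 - Real.exp (-∑ i, u i))) :
    Integrable h (levyMeasure ν) := by
  rw [levyMeasure, integrable_withDensity_iff_integrable_smul measurable_levyDensity]
  refine Integrable.of_bound (measurable_levyDensity.smul hm).aestronglyMeasurable B ?_
  filter_upwards [ae_restrict_mem (measurableSet_posPart n)] with u hu
  have hp := one_sub_exp_neg_sum_pos hu
  rw [NNReal.smul_def, smul_eq_mul, Real.coe_toNNReal _ (inv_nonneg.2 hp.le), norm_mul,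
    Real.norm_of_nonneg (inv_nonneg.2 hp.le), Real.norm_eq_abs, inv_mul_le_iff₀ hp, mul_comm]
  exact hB u hu

lemma goodMeasure_levyMeasure [IsFiniteMeasure ν] : GoodMeasure n (levyMeasure ν) := by
  refine ⟨1, one_pos, fun j => ?_, ?_⟩
  · rw [← integrable_indicator_iff (measurableSet_smallBox n 1)]
    refine integrable_levyMeasure
      ((measurable_pi_apply j).indicator (measurableSet_smallBox n 1)) (B := 1 + n) fun u hu => ?_
    have hp := one_sub_exp_neg_sum_pos hu
    by_cases hus : u ∈ smallBox n 1
    · rw [indicator_of_mem hus, abs_of_nonneg (hu.1 j)]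
      have h1 : u j ≤ ∑ i, u i :=
        Finset.single_le_sum (fun i _ => hu.1 i) (Finset.mem_univ j)
      have h2 : ∑ i, u i ≤ n := by
        simpa using Finset.sum_le_sum fun i (_ : i ∈ Finset.univ) => (hus.1 i).2.le
      refine (h1.trans (sum_le_mul_one_sub_exp hu.1)).trans ?_
      exact mul_le_mul_of_nonneg_right (by linarith) hp.le
    · rw [indicator_of_notMem hus, abs_zero]
      positivity
  · have h1 : Integrable ((farPart n 1).indicator fun _ => (1 : ℝ)) (levyMeasure ν) := by
      refine integrable_levyMeasure
        (measurable_const.indicator (measurableSet_farPart n 1)) (B := 2) fun u hu => ?_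
      have hp := one_sub_exp_neg_sum_pos hu
      by_cases huf : u ∈ farPart n 1
      · rw [indicator_of_mem huf, abs_one]
        obtain ⟨i, hi⟩ := not_forall.1 huf.2
        have h1 : u i ≤ ∑ i, u i :=
          Finset.single_le_sum (fun i _ => hu.1 i) (Finset.mem_univ i)
        have h2 := sum_le_mul_one_sub_exp hu.1
        nlinarith
      · rw [indicator_of_notMem huf, abs_zero]
        positivity
    rw [integrable_indicator_iff (measurableSet_farPart n 1)] at h1
    simpa using (integrableOn_const_iff (C := (1 : ℝ))).1 h1

lemma integrableOn_exp_sub_one_levyMeasure [IsFiniteMeasure ν] {s : Fin n → ℝ} (hs : s ≤ 0) :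
    IntegrableOn (fun u => Real.exp (∑ i, s i * u i) - 1) (posPart n) (levyMeasure ν) := by
  obtain ⟨K, hK⟩ := exists_nat_one_sub_exp_le s
  refine (integrable_levyMeasure (by fun_prop) (B := K) fun u hu => ?_).integrableOn
  rw [abs_sub_comm, abs_of_nonneg (by simpa using sum_mul_nonpos hs hu.1)]
  exact hK u hu.1

lemma setIntegral_exp_sub_one_levyMeasure (hν : ν (Ici 0)ᶜ = 0) (s : Fin n → ℝ) :
    ∫ u in posPart n, (Real.exp (∑ i, s i * u i) - 1) ∂levyMeasure ν =
      -∫ u, (1 - Real.exp (∑ i, s i * u i)) / (1 - Real.exp (-∑ i, u i)) ∂ν := by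
  have hset : ∫ u in posPart n,
      -((1 - Real.exp (∑ i, s i * u i)) / (1 - Real.exp (-∑ i, u i))) ∂ν =
      ∫ u, -((1 - Real.exp (∑ i, s i * u i)) / (1 - Real.exp (-∑ i, u i))) ∂ν := by
    refine setIntegral_eq_integral_of_ae_compl_eq_zero ?_
    filter_upwards [ae_nonneg_of_compl_Ici hν] with u hu hu'
    have : u = 0 := by
      by_contra h
      exact hu' ⟨hu, h⟩
    simp [this]
  rw [levyMeasure_restrict_posPart, levyMeasure,
    integral_withDensity_eq_integral_smul measurable_levyDensity, ← integral_neg, ← hset]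
  refine setIntegral_congr_fun (measurableSet_posPart n) fun u hu => ?_
  have hp := one_sub_exp_neg_sum_pos hu
  simp only [NNReal.smul_def, smul_eq_mul, Real.coe_toNNReal _ (inv_nonneg.2 hp.le)]
  field_simp
  ring

end LevyMeasure

section MemT

variable {n : ℕ} {ψ : (Fin n → ℝ) → ℝ}

lemma MemT.iteratedFDeriv_nonneg (hψ : MemT n ψ) (k : ℕ) (m : Fin (k + 1) → Fin n)
    {x : Fin n → ℝ} (hx : x ∈ negOrthant n) :
    0 ≤ iteratedFDeriv ℝ (k + 1) ψ x (fun i => Pi.single (m i) 1) := by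
  rw [← iteratedFDerivWithin_of_isOpen (k + 1) (isOpen_negOrthant n) hx]
  exact hψ.2.2 k m x hx

lemma MemT.monotoneOn_iteratedFDeriv (hψ : MemT n ψ) (k : ℕ) (m : Fin k → Fin n) :
    MonotoneOn (fun x => iteratedFDeriv ℝ k ψ x (fun i => Pi.single (m i) 1)) (negOrthant n) := by
  refine monotoneOn_iteratedFDeriv_apply hψ.1 k _ fun x hx i => ?_
  convert hψ.iteratedFDeriv_nonneg k (Fin.cons i m) hx using 2
  exact funext fun j => Fin.cases rfl (fun _ => rfl) j

lemma MemT.monotoneOn (hψ : MemT n ψ) : MonotoneOn ψ (negOrthant n) := by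
  simpa using hψ.monotoneOn_iteratedFDeriv 0 Fin.elim0

lemma MemT.monotoneOn_fderiv (hψ : MemT n ψ) (j : Fin n) :
    MonotoneOn (fun s => fderiv ℝ ψ s (Pi.single j 1)) (negOrthant n) := by
  simpa using hψ.monotoneOn_iteratedFDeriv 1 fun _ => j

lemma MemT.fderiv_nonneg (hψ : MemT n ψ) (j : Fin n) {s : Fin n → ℝ} (hs : s ∈ negOrthant n) :
    0 ≤ fderiv ℝ ψ s (Pi.single j 1) := by
  simpa using hψ.iteratedFDeriv_nonneg 0 (fun _ => j) hs

lemma sub_one_mem_negOrthant {s : Fin n → ℝ} (hs : s ∈ negOrthant n) : s - 1 ∈ negOrthant n :=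
  fun i => by
    have := hs i
    change s i - 1 < 0
    linarith

lemma MemT.contDiffOn_comp_sub_one (hψ : MemT n ψ) :
    ContDiffOn ℝ (⊤ : ℕ∞) (fun s => ψ (s - 1)) (negOrthant n) :=
  hψ.1.comp (by fun_prop) fun _ hs => sub_one_mem_negOrthant hs

lemma MemT.iteratedFDeriv_sub_comp_sub_one_nonneg (hψ : MemT n ψ) (k : ℕ) (m : Fin k → Fin n)
    {x : Fin n → ℝ} (hx : x ∈ negOrthant n) :
    0 ≤ iteratedFDeriv ℝ k (ψ - fun s => ψ (s - 1)) x (fun i => Pi.single (m i) 1) := by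
  have hnhds := (isOpen_negOrthant n).mem_nhds hx
  have hk : (k : WithTop ℕ∞) ≤ ((⊤ : ℕ∞) : WithTop ℕ∞) := by exact_mod_cast le_top
  rw [iteratedFDeriv_sub_apply ((hψ.1.contDiffAt hnhds).of_le hk)
    ((hψ.contDiffOn_comp_sub_one.contDiffAt hnhds).of_le hk), iteratedFDeriv_comp_sub,
    sub_apply, sub_nonneg]
  exact hψ.monotoneOn_iteratedFDeriv k m (sub_one_mem_negOrthant hx) hx fun i => by simp

lemma tendsto_integral_exp_of_tendsto_zero {ν : Measure (Fin n → ℝ)} [IsFiniteMeasure ν]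
    (hν : ν (Ici 0)ᶜ = 0) :
    Tendsto (fun s => ∫ u, Real.exp (∑ i, s i * u i) ∂ν) (nhdsWithin 0 (negOrthant n))
      (nhds (ν.real univ)) := by
  have h1 : ν.real univ = ∫ u : Fin n → ℝ, (1 : ℝ) ∂ν := by simp
  rw [h1]
  refine tendsto_integral_filter_of_dominated_convergence (fun _ => 1)
    (Eventually.of_forall fun s => Continuous.aestronglyMeasurable (by fun_prop)) ?_
    (integrable_const _) ?_
  · filter_upwards [self_mem_nhdsWithin] with s hs
    filter_upwards [ae_nonneg_of_compl_Ici hν] with u hu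
    rw [Real.norm_eq_abs, Real.abs_exp, Real.exp_le_one_iff]
    exact sum_mul_nonpos (fun i => (hs i).le) hu
  · refine Eventually.of_forall fun u => ?_
    have hc : Continuous fun s : Fin n → ℝ => Real.exp (∑ i, s i * u i) := by fun_prop
    simpa using (hc.tendsto 0).mono_left nhdsWithin_le_nhds

end MemT

/-- integral representation of functions of class `T_n`.
Every `ψ ∈ T_n` can be written as
`ψ(s) = c₀ + c₁·s + ∫_{ℝ₊ⁿ∖{0}} (e^{s·u} − 1) dμ(u)` for `s ∈ (−∞,0)ⁿ`, where
`c₀ = ψ(−0) ≤ 0`, `c₁ = ∇ψ(−∞) ∈ ℝ₊ⁿ`, and `μ` is a positive measure on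
`ℝ₊ⁿ∖{0}` such that for small `δ > 0` the coordinate functions are
`μ`-integrable on `[0,δ)ⁿ∖{0}` and `μ(ℝ₊ⁿ∖[0,δ)ⁿ) < ∞`. -/
theorem bernstein_integral_representation (n : ℕ) (ψ : (Fin n → ℝ) → ℝ)
    (hψ : MemT n ψ) :
    ∃ (c₀ : ℝ) (c₁ : Fin n → ℝ) (μ : Measure (Fin n → ℝ)),
      c₀ ≤ 0 ∧ (∀ j, 0 ≤ c₁ j) ∧
      Tendsto ψ (nhdsWithin 0 (negOrthant n)) (nhds c₀) ∧
      (∀ j, Tendsto (fun s => fderivWithin ℝ ψ (negOrthant n) s (Pi.single j 1))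
        atBot (nhds (c₁ j))) ∧
      GoodMeasure n μ ∧ μ (posPart n)ᶜ = 0 ∧
      ∀ s ∈ negOrthant n,
        IntegrableOn (fun u => Real.exp (∑ i, s i * u i) - 1) (posPart n) μ ∧
        ψ s = c₀ + ∑ j, c₁ j * s j +
          ∫ u in posPart n, (Real.exp (∑ i, s i * u i) - 1) ∂μ := by
  obtain ⟨c₀, hc₀, hc₀lim⟩ := exists_tendsto_nhdsWithin_zero_of_monotoneOn hψ.monotoneOn hψ.2.1
  choose c hc hclim using fun j =>
    exists_tendsto_atBot_of_monotoneOn (hψ.monotoneOn_fderiv j) fun s hs => hψ.fderiv_nonneg j hs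
  have hlim : Tendsto (ψ - fun s => ψ (s - 1)) (nhdsWithin 0 (negOrthant n))
      (nhds (c₀ - ψ fun _ => -1)) := by
    have h1 : ContinuousAt ψ (fun _ => -1) :=
      hψ.1.continuousOn.continuousAt ((isOpen_negOrthant n).mem_nhds (neg_one_mem_negOrthant n))
    have h2 : Tendsto (fun s : Fin n → ℝ => s - 1) (nhdsWithin 0 (negOrthant n))
        (nhds fun _ => -1) := by
      have h3 : Continuous fun s : Fin n → ℝ => s - 1 := by fun_prop
      convert (h3.tendsto 0).mono_left nhdsWithin_le_nhds using 2
      ext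
      simp
    exact hc₀lim.sub (h1.tendsto.comp h2)
  obtain ⟨ν, hν, hrep⟩ := exists_finiteMeasure_eq_integral_exp
    (hψ.1.sub hψ.contDiffOn_comp_sub_one)
    (fun k m x hx => hψ.iteratedFDeriv_sub_comp_sub_one_nonneg k m hx) hlim
  have hmass : c₀ - ψ (fun _ => -1) = (ν : Measure (Fin n → ℝ)).real univ :=
    tendsto_nhds_unique hlim ((tendsto_integral_exp_of_tendsto_zero hν).congr'
      (by filter_upwards [self_mem_nhdsWithin] with s hs using (hrep s hs).symm))
  refine ⟨c₀, c, levyMeasure (ν : Measure (Fin n → ℝ)), hc₀, hc, hc₀lim, fun j => ?_,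
    goodMeasure_levyMeasure, levyMeasure_compl_posPart, fun s hs =>
    ⟨integrableOn_exp_sub_one_levyMeasure fun i => (hs i).le, ?_⟩⟩
  · refine (hclim j).congr' ?_
    filter_upwards [eventually_le_atBot (fun _ => -1 : Fin n → ℝ)] with s hs
    have hs' : s ∈ negOrthant n := fun i => (hs i).trans_lt (by norm_num)
    rw [fderivWithin_of_isOpen (isOpen_negOrthant n) hs']
  · rw [setIntegral_exp_sub_one_levyMeasure hν, integral_one_sub_exp_div_eq hν hrep hmass hs
      (tendsto_sub_of_tendsto_partialDeriv hψ.1 hψ.monotoneOn_fderiv hclim hs)]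
    ring
end
end

section
/- Let (ψ_k) be a sequence of functions of class T_n that converges pointwise on (−∞,0)ⁿ to a function ψ defined on (−∞,0)ⁿ. Then ψ belongs to T_n. -/
open MeasureTheory Filter Set

noncomputable section

/-- The partial derivative of `f` in the `i`-th coordinate direction on the negative orthant. -/
def partialDeriv (n : ℕ) (i : Fin n) (f : (Fin n → ℝ) → ℝ) (x : Fin n → ℝ) : ℝ :=
  fderivWithin ℝ f (negOrthant n) x (Pi.single i 1)

/-- Smooth functions on the negative orthant all of whose partial derivatives of
order at least one are nonnegative. -/
def PosPartials (n : ℕ) (f : (Fin n → ℝ) → ℝ) : Prop :=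
  ContDiffOn ℝ (⊤ : ℕ∞) f (negOrthant n) ∧
  ∀ (k : ℕ) (m : Fin (k + 1) → Fin n), ∀ x ∈ negOrthant n,
    0 ≤ iteratedFDerivWithin ℝ (k + 1) f (negOrthant n) x (fun i => Pi.single (m i) 1)

lemma add_const_mem_closedBall {n : ℕ} (x : Fin n → ℝ) {r : ℝ} (hr : 0 ≤ r) :
    (x + fun _ => r) ∈ Metric.closedBall x r := by
  rw [mem_closedBall_iff_norm, add_sub_cancel_left]
  exact (pi_norm_const_le r).trans_eq (Real.norm_of_nonneg hr)

lemma sub_const_mem_closedBall {n : ℕ} (x : Fin n → ℝ) {r : ℝ} (hr : 0 ≤ r) :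
    (x - fun _ => r) ∈ Metric.closedBall x r := by
  rw [mem_closedBall_iff_norm', sub_sub_cancel]
  exact (pi_norm_const_le r).trans_eq (Real.norm_of_nonneg hr)

lemma apply_eq_sum_single {n : ℕ} (L : (Fin n → ℝ) →L[ℝ] ℝ) (v : Fin n → ℝ) :
    L v = ∑ i, v i * L (Pi.single i 1) := by
  conv_lhs => rw [pi_eq_sum_univ' v, map_sum]
  refine Finset.sum_congr rfl fun i _ => ?_
  rw [map_smul, smul_eq_mul]

lemma opNorm_le_of_single_le {n : ℕ} (L : (Fin n → ℝ) →L[ℝ] ℝ) {M : ℝ} (hM : 0 ≤ M)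
    (h : ∀ i, |L (Pi.single i 1)| ≤ M) : ‖L‖ ≤ n * M := by
  refine L.opNorm_le_bound (by positivity) fun v => ?_
  rw [apply_eq_sum_single L v]
  calc ‖∑ i, v i * L (Pi.single i 1)‖ ≤ ∑ i : Fin n, ‖v i * L (Pi.single i 1)‖ := norm_sum_le _ _
    _ ≤ ∑ _i : Fin n, ‖v‖ * M := by
        refine Finset.sum_le_sum fun i _ => ?_
        rw [norm_mul]
        exact mul_le_mul (norm_le_pi_norm v i) (h i) (norm_nonneg _) (norm_nonneg _)
    _ = n * M * ‖v‖ := by simp; ring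

lemma contDiffOn_partialDeriv {n : ℕ} (i : Fin n) {f : (Fin n → ℝ) → ℝ}
    (hf : ContDiffOn ℝ (⊤ : ℕ∞) f (negOrthant n)) :
    ContDiffOn ℝ (⊤ : ℕ∞) (partialDeriv n i f) (negOrthant n) :=
  (hf.fderivWithin (isOpen_negOrthant n).uniqueDiffOn (by simp)).clm_apply contDiffOn_const

lemma iteratedFDerivWithin_succ_partialDeriv {n : ℕ} {f : (Fin n → ℝ) → ℝ}
    (hf : ContDiffOn ℝ (⊤ : ℕ∞) f (negOrthant n)) (k : ℕ) (m : Fin (k + 1) → Fin n)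
    {x : Fin n → ℝ} (hx : x ∈ negOrthant n) :
    iteratedFDerivWithin ℝ (k + 1) f (negOrthant n) x (fun i => Pi.single (m i) 1) =
      iteratedFDerivWithin ℝ k (partialDeriv n (m (Fin.last k)) f) (negOrthant n) x
        (fun i => Pi.single (m i.castSucc) 1) := by
  have hU := (isOpen_negOrthant n).uniqueDiffOn (𝕜 := ℝ)
  have hd : ContDiffOn ℝ (⊤ : ℕ∞) (fderivWithin ℝ f (negOrthant n)) (negOrthant n) :=
    hf.fderivWithin hU (by simp)
  rw [iteratedFDerivWithin_succ_apply_right hU hx]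
  have := (ContinuousLinearMap.apply ℝ ℝ (Pi.single (m (Fin.last k)) (1 : ℝ) :
    Fin n → ℝ)).iteratedFDerivWithin_comp_left (hd.of_le (by exact_mod_cast le_top) x hx) hU hx
    (i := k) le_rfl
  change _ = iteratedFDerivWithin ℝ k
    ((ContinuousLinearMap.apply ℝ ℝ (Pi.single (m (Fin.last k)) (1 : ℝ) : Fin n → ℝ)) ∘
      fderivWithin ℝ f (negOrthant n)) (negOrthant n) x _
  rw [this]
  rfl

namespace PosPartials

variable {n : ℕ} {f : (Fin n → ℝ) → ℝ}

lemma partialDeriv (hf : PosPartials n f) (i : Fin n) : PosPartials n (partialDeriv n i f) := by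
  refine ⟨contDiffOn_partialDeriv i hf.1, fun k m x hx => ?_⟩
  have := hf.2 (k + 1) (Fin.snoc m i) x hx
  rw [iteratedFDerivWithin_succ_partialDeriv hf.1 _ _ hx] at this
  simpa using this

lemma partialDeriv_nonneg (hf : PosPartials n f) (i : Fin n) {x : Fin n → ℝ}
    (hx : x ∈ negOrthant n) : 0 ≤ _root_.partialDeriv n i f x := by
  have := hf.2 0 (fun _ => i) x hx
  rw [iteratedFDerivWithin_succ_partialDeriv hf.1 _ _ hx] at this
  simpa using this

lemma hasFDerivWithinAt (hf : PosPartials n f) {x : Fin n → ℝ} (hx : x ∈ negOrthant n) :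
    HasFDerivWithinAt f (fderivWithin ℝ f (negOrthant n) x) (negOrthant n) x :=
  (hf.1.differentiableOn (by simp) x hx).hasFDerivWithinAt

lemma mono (hf : PosPartials n f) {x y : Fin n → ℝ} (hx : x ∈ negOrthant n)
    (hy : y ∈ negOrthant n) (hxy : x ≤ y) : f x ≤ f y := by
  obtain ⟨z, hz, h⟩ := domain_mvt (fun z hz => hf.hasFDerivWithinAt hz) (convex_negOrthant n) hx hy
  have hzU := (convex_negOrthant n).segment_subset hx hy hz
  rw [apply_eq_sum_single] at h
  have : 0 ≤ f y - f x := by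
    rw [h]
    exact Finset.sum_nonneg fun i _ =>
      mul_nonneg (sub_nonneg.2 (hxy i)) (hf.partialDeriv_nonneg i hzU)
  linarith

lemma mul_partialDeriv_le (hf : PosPartials n f) (i : Fin n) {δ : ℝ} (hδ : 0 ≤ δ) {x : Fin n → ℝ}
    (hx : x ∈ negOrthant n) (hy : x + δ • Pi.single i 1 ∈ negOrthant n) :
    δ * _root_.partialDeriv n i f x ≤ f (x + δ • Pi.single i 1) - f x := by
  obtain ⟨z, hz, h⟩ := domain_mvt (fun z hz => hf.hasFDerivWithinAt hz) (convex_negOrthant n) hx hy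
  have hzU := (convex_negOrthant n).segment_subset hx hy hz
  have hxy : x ≤ x + δ • Pi.single i 1 :=
    le_add_of_nonneg_right (smul_nonneg hδ (Pi.single_nonneg.2 zero_le_one))
  have hxz : x ≤ z := (segment_subset_Icc hxy hz).1
  rw [h, add_sub_cancel_left, map_smul, smul_eq_mul]
  exact mul_le_mul_of_nonneg_left ((hf.partialDeriv i).mono hx hzU hxz) hδ

lemma sq_mul_partialDeriv_partialDeriv_le (hf : PosPartials n f) (i j : Fin n) {δ : ℝ}
    (hδ : 0 < δ) {x z : Fin n → ℝ}
    (hball : Metric.closedBall x (3 * δ) ⊆ negOrthant n) (hz : z ∈ Metric.closedBall x δ) :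
    δ ^ 2 * _root_.partialDeriv n j (_root_.partialDeriv n i f) z ≤
      f (x + fun _ => 3 * δ) - f (x - fun _ => 3 * δ) := by
  have hc := hball (add_const_mem_closedBall x (r := 3 * δ) (by positivity))
  have ha := hball (sub_const_mem_closedBall x (r := 3 * δ) (by positivity))
  have hzle : ∀ l, |z l - x l| ≤ δ := fun l =>
    (norm_le_pi_norm (z - x) l).trans (mem_closedBall_iff_norm.1 hz)
  have hs : ∀ l m : Fin n, 0 ≤ (δ • Pi.single m (1 : ℝ) : Fin n → ℝ) l ∧
      (δ • Pi.single m (1 : ℝ) : Fin n → ℝ) l ≤ δ := by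
    intro l m
    by_cases h : l = m <;> simp [h, hδ.le]
  have hU : ∀ w : Fin n → ℝ, w ≤ (x + fun _ => 3 * δ) → w ∈ negOrthant n :=
    fun w hw l => (hw l).trans_lt (hc l)
  have hz0 : z ∈ negOrthant n := hU _ fun l => by
    have := abs_le.1 (hzle l)
    simp only [Pi.add_apply]
    linarith
  have hz1 : z + δ • Pi.single j 1 ∈ negOrthant n := hU _ fun l => by
    have := abs_le.1 (hzle l)
    have := hs l j
    simp only [Pi.add_apply]
    linarith
  have hle2 : z + δ • Pi.single j 1 + δ • Pi.single i 1 ≤ x + fun _ => 3 * δ := fun l => by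
    have := abs_le.1 (hzle l)
    have := hs l j
    have := hs l i
    simp only [Pi.add_apply]
    linarith
  have hz2 := hU _ hle2
  have hge : (x - fun _ => 3 * δ) ≤ z + δ • Pi.single j 1 := fun l => by
    have := abs_le.1 (hzle l)
    have := hs l j
    simp only [Pi.add_apply, Pi.sub_apply]
    linarith
  have h1 := (hf.partialDeriv i).mul_partialDeriv_le j hδ.le hz0 hz1
  have h2 := hf.mul_partialDeriv_le i hδ.le hz1 hz2
  have h3 := hf.mono hz2 hc hle2
  have h4 := hf.mono ha hz1 hge
  have h5 := hf.partialDeriv_nonneg i hz0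
  nlinarith

/-- Second-order Taylor estimate with a constant controlled by the oscillation of `f`. -/
lemma abs_sub_sub_fderivWithin_le (hf : PosPartials n f) {δ M : ℝ}
    (hδ : 0 < δ) {x y : Fin n → ℝ}
    (hball : Metric.closedBall x (3 * δ) ⊆ negOrthant n)
    (hM : f (x + fun _ => 3 * δ) - f (x - fun _ => 3 * δ) ≤ M) (hM0 : 0 ≤ M)
    (hy : y ∈ Metric.closedBall x δ) :
    ‖f y - f x - fderivWithin ℝ f (negOrthant n) x (y - x)‖ ≤
      n * (n * (M / δ ^ 2)) * ‖y - x‖ ^ 2 := by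
  have hsub : Metric.closedBall x δ ⊆ negOrthant n :=
    (Metric.closedBall_subset_closedBall (by linarith)).trans hball
  have hxδ : x ∈ Metric.closedBall x δ := Metric.mem_closedBall_self hδ.le
  have hpart : ∀ i, ∀ z ∈ Metric.closedBall x δ,
      ‖_root_.partialDeriv n i f z - _root_.partialDeriv n i f x‖ ≤
        n * (M / δ ^ 2) * ‖z - x‖ := by
    intro i z hz
    refine (convex_closedBall x δ).norm_image_sub_le_of_norm_hasFDerivWithin_le
      (fun w hw => ((hf.partialDeriv i).hasFDerivWithinAt (hsub hw)).mono hsub)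
      (fun w hw => opNorm_le_of_single_le _ (by positivity) fun j => ?_) hxδ hz
    have h0 := (hf.partialDeriv i).partialDeriv_nonneg j (hsub hw)
    have h1 := hf.sq_mul_partialDeriv_partialDeriv_le i j hδ hball hw
    change |_root_.partialDeriv n j (_root_.partialDeriv n i f) w| ≤ _
    rw [abs_of_nonneg h0, le_div_iff₀ (by positivity)]
    linarith
  have hyd : ‖y - x‖ ≤ δ := mem_closedBall_iff_norm.1 hy
  have hsub' : Metric.closedBall x ‖y - x‖ ⊆ Metric.closedBall x δ :=
    Metric.closedBall_subset_closedBall hyd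
  have := (convex_closedBall x ‖y - x‖).norm_image_sub_le_of_norm_hasFDerivWithin_le'
    (f := f) (f' := fderivWithin ℝ f (negOrthant n)) (φ := fderivWithin ℝ f (negOrthant n) x)
    (C := n * (n * (M / δ ^ 2) * ‖y - x‖)) (x := x) (y := y)
    (fun w hw => (hf.hasFDerivWithinAt (hsub (hsub' hw))).mono (hsub'.trans hsub))
    (fun w hw => opNorm_le_of_single_le _ (by positivity) fun i => ?_)
    (Metric.mem_closedBall_self (norm_nonneg _)) (mem_closedBall_iff_norm.2 le_rfl)
  · refine this.trans_eq ?_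
    ring
  · refine (hpart i w (hsub' hw)).trans ?_
    exact mul_le_mul_of_nonneg_left (mem_closedBall_iff_norm.1 hw) (by positivity)

end PosPartials

/-- If functions `u k` converge pointwise near `x` and are approximated by linear maps `L k` at `x`
to second order, uniformly in `k`, then the `L k` converge to the derivative of the limit. -/
lemma exists_hasFDerivAt_of_uniform_quadratic {n : ℕ} {u : ℕ → (Fin n → ℝ) → ℝ}
    {v : (Fin n → ℝ) → ℝ} {L : ℕ → (Fin n → ℝ) →L[ℝ] ℝ} {x : Fin n → ℝ} {C δ : ℝ} (hδ : 0 < δ)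
    (hL : ∀ k, ∀ y ∈ Metric.closedBall x δ, ‖u k y - u k x - L k (y - x)‖ ≤ C * ‖y - x‖ ^ 2)
    (huv : ∀ y ∈ Metric.closedBall x δ, Tendsto (fun k => u k y) atTop (nhds (v y))) :
    ∃ G : (Fin n → ℝ) →L[ℝ] ℝ, HasFDerivAt v G x ∧
      ∀ w, Tendsto (fun k => L k w) atTop (nhds (G w)) := by
  have hx := Metric.mem_closedBall_self (x := x) hδ.le
  have hcauchy : ∀ i : Fin n, CauchySeq fun k => L k (Pi.single i 1) := by
    intro i
    rw [Metric.cauchySeq_iff']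
    intro ε hε
    obtain ⟨s, hs0, hsδ, hsε⟩ : ∃ s : ℝ, 0 < s ∧ s ≤ δ ∧ C * s ≤ ε / 4 := by
      refine ⟨min δ (ε / (4 * (|C| + 1))), by positivity, min_le_left _ _, ?_⟩
      have h1 : min δ (ε / (4 * (|C| + 1))) ≤ ε / (4 * (|C| + 1)) := min_le_right _ _
      have h0 : 0 < min δ (ε / (4 * (|C| + 1))) := by positivity
      rw [le_div_iff₀ (by positivity)] at h1
      nlinarith [le_abs_self C]
    have hnorm : ‖s • (Pi.single i 1 : Fin n → ℝ)‖ = s := by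
      rw [norm_smul, Pi.norm_single]
      simp [abs_of_pos hs0]
    have hy : x + s • Pi.single i 1 ∈ Metric.closedBall x δ := by
      rw [mem_closedBall_iff_norm, add_sub_cancel_left, hnorm]
      exact hsδ
    have hq := ((huv _ hy).sub (huv x hx)).cauchySeq
    rw [Metric.cauchySeq_iff'] at hq
    obtain ⟨N, hN⟩ := hq (s * (ε / 2)) (by positivity)
    refine ⟨N, fun k hk => ?_⟩
    have h1 := hL k _ hy
    have h2 := hL N _ hy
    have h3 := hN k hk
    rw [add_sub_cancel_left, hnorm, map_smul, smul_eq_mul, Real.norm_eq_abs, abs_le] at h1 h2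
    rw [Real.dist_eq, abs_lt] at h3 ⊢
    have h4 : C * s ^ 2 ≤ s * (ε / 4) := by nlinarith
    constructor
    · refine lt_of_mul_lt_mul_left ?_ hs0.le
      linarith
    · refine lt_of_mul_lt_mul_left ?_ hs0.le
      linarith
  choose g hg using fun i => cauchySeq_tendsto_of_complete (hcauchy i)
  let G : (Fin n → ℝ) →L[ℝ] ℝ := ∑ i, g i • ContinuousLinearMap.proj i
  have hG : ∀ w, Tendsto (fun k => L k w) atTop (nhds (G w)) := by
    intro w
    have : G w = ∑ i, w i * g i := by simp [G, mul_comm]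
    rw [this]
    simp_rw [fun k => apply_eq_sum_single (L k) w]
    exact tendsto_finsetSum _ fun i _ => (hg i).const_mul _
  refine ⟨G, ?_, hG⟩
  have hquad : ∀ y ∈ Metric.closedBall x δ, ‖v y - v x - G (y - x)‖ ≤ C * ‖y - x‖ ^ 2 :=
    fun y hy => le_of_tendsto (((huv y hy).sub (huv x hx)).sub (hG _)).norm
      (Eventually.of_forall fun k => hL k y hy)
  have hO : (fun y => v y - v x - G (y - x)) =O[nhds x] fun y => ‖y - x‖ ^ 2 := by
    refine Asymptotics.IsBigO.of_bound C ?_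
    filter_upwards [Metric.closedBall_mem_nhds x hδ] with y hy
    simpa using hquad y hy
  exact .of_isLittleO (hO.trans_isLittleO (Asymptotics.isLittleO_pow_sub_sub x one_lt_two))

lemma PosPartials.exists_hasFDerivAt_limit {n : ℕ} {u : ℕ → (Fin n → ℝ) → ℝ}
    (hu : ∀ k, PosPartials n (u k)) {v : (Fin n → ℝ) → ℝ}
    (huv : ∀ s ∈ negOrthant n, Tendsto (fun k => u k s) atTop (nhds (v s)))
    {x : Fin n → ℝ} (hx : x ∈ negOrthant n) :
    ∃ G : (Fin n → ℝ) →L[ℝ] ℝ, HasFDerivAt v G x ∧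
      ∀ w, Tendsto (fun k => fderivWithin ℝ (u k) (negOrthant n) x w) atTop (nhds (G w)) := by
  obtain ⟨ε, hε, hball⟩ := Metric.nhds_basis_closedBall.mem_iff.1 ((isOpen_negOrthant n).mem_nhds hx)
  obtain ⟨δ, hδ, rfl⟩ : ∃ δ > 0, ε = 3 * δ := ⟨ε / 3, by positivity, by ring⟩
  have hc := hball (add_const_mem_closedBall x (r := 3 * δ) (by positivity))
  have ha := hball (sub_const_mem_closedBall x (r := 3 * δ) (by positivity))
  obtain ⟨M, hM⟩ := ((huv _ hc).sub (huv _ ha)).bddAbove_range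
  refine exists_hasFDerivAt_of_uniform_quadratic hδ (fun k y hy =>
    (hu k).abs_sub_sub_fderivWithin_le hδ hball
      ((hM (mem_range_self k)).trans (le_max_left M 0)) (le_max_right M 0) hy) fun y hy => huv y ?_
  exact hball (Metric.closedBall_subset_closedBall (by linarith) hy)

lemma PosPartials.tendsto_partialDeriv {n : ℕ} {u : ℕ → (Fin n → ℝ) → ℝ}
    (hu : ∀ k, PosPartials n (u k)) {v : (Fin n → ℝ) → ℝ}
    (huv : ∀ s ∈ negOrthant n, Tendsto (fun k => u k s) atTop (nhds (v s))) (i : Fin n)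
    {x : Fin n → ℝ} (hx : x ∈ negOrthant n) :
    Tendsto (fun k => _root_.partialDeriv n i (u k) x) atTop
      (nhds (_root_.partialDeriv n i v x)) := by
  obtain ⟨G, hG, h⟩ := exists_hasFDerivAt_limit hu huv hx
  have := hG.hasFDerivWithinAt.fderivWithin ((isOpen_negOrthant n).uniqueDiffWithinAt hx)
  unfold _root_.partialDeriv
  rw [this]
  exact h _

lemma PosPartials.contDiffOn_limit {n : ℕ} (r : ℕ) {u : ℕ → (Fin n → ℝ) → ℝ}
    (hu : ∀ k, PosPartials n (u k)) {v : (Fin n → ℝ) → ℝ}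
    (huv : ∀ s ∈ negOrthant n, Tendsto (fun k => u k s) atTop (nhds (v s))) :
    ContDiffOn ℝ r v (negOrthant n) := by
  have hdiff : DifferentiableOn ℝ v (negOrthant n) := fun x hx => by
    obtain ⟨G, hG, -⟩ := exists_hasFDerivAt_limit hu huv hx
    exact hG.differentiableAt.differentiableWithinAt
  induction r generalizing u v with
  | zero => exact contDiffOn_zero.2 hdiff.continuousOn
  | succ r ih =>
    have hpart : ∀ i, ContDiffOn ℝ r (_root_.partialDeriv n i v) (negOrthant n) := fun i => by
      have hu' := fun k => (hu k).partialDeriv i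
      have huv' := fun s hs => tendsto_partialDeriv hu huv i (x := s) hs
      refine ih hu' huv' fun x hx => ?_
      obtain ⟨G, hG, -⟩ := exists_hasFDerivAt_limit hu' huv' hx
      exact hG.differentiableAt.differentiableWithinAt
    rw [Nat.cast_succ, contDiffOn_succ_iff_fderivWithin (isOpen_negOrthant n).uniqueDiffOn]
    refine ⟨hdiff, by simp, contDiffOn_clm_apply.2 fun w => ?_⟩
    simp_rw [fun x => apply_eq_sum_single (fderivWithin ℝ v (negOrthant n) x) w]
    exact ContDiffOn.sum fun i _ => contDiffOn_const.mul (hpart i)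

lemma PosPartials.tendsto_iteratedFDerivWithin {n : ℕ} {u : ℕ → (Fin n → ℝ) → ℝ}
    (hu : ∀ k, PosPartials n (u k)) {v : (Fin n → ℝ) → ℝ}
    (huv : ∀ s ∈ negOrthant n, Tendsto (fun k => u k s) atTop (nhds (v s))) (r : ℕ)
    (m : Fin r → Fin n) {x : Fin n → ℝ} (hx : x ∈ negOrthant n) :
    Tendsto (fun k => iteratedFDerivWithin ℝ r (u k) (negOrthant n) x
        (fun i => Pi.single (m i) 1)) atTop
      (nhds (iteratedFDerivWithin ℝ r v (negOrthant n) x (fun i => Pi.single (m i) 1))) := by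
  induction r generalizing u v with
  | zero => simpa using huv x hx
  | succ r ih =>
    simp_rw [fun k => iteratedFDerivWithin_succ_partialDeriv (hu k).1 r m hx]
    rw [iteratedFDerivWithin_succ_partialDeriv
      (contDiffOn_infty.2 fun r => contDiffOn_limit r hu huv) r m hx]
    exact ih (fun k => (hu k).partialDeriv _)
      (fun s hs => tendsto_partialDeriv hu huv _ hs) _

/-- if a sequence of functions of class `T_n` converges
pointwise on `(−∞,0)ⁿ` to a function `ψ`, then `ψ ∈ T_n`. -/
theorem memT_of_pointwise_limit (n : ℕ) (ψk : ℕ → (Fin n → ℝ) → ℝ)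
    (hk : ∀ k, MemT n (ψk k)) (ψ : (Fin n → ℝ) → ℝ)
    (hconv : ∀ s ∈ negOrthant n, Tendsto (fun k => ψk k s) atTop (nhds (ψ s))) :
    MemT n ψ := by
  have hpos : ∀ k, PosPartials n (ψk k) := fun k => ⟨(hk k).1, (hk k).2.2⟩
  refine ⟨contDiffOn_infty.2 fun r => PosPartials.contDiffOn_limit r hpos hconv, fun x hx => ?_,
    fun r m x hx => ?_⟩
  · exact le_of_tendsto (hconv x hx) (Eventually.of_forall fun k => (hk k).2.1 x hx)
  · exact ge_of_tendsto (PosPartials.tendsto_iteratedFDerivWithin hpos hconv _ m hx)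
      (Eventually.of_forall fun k => (hk k).2.2 r m x hx)
end
end

section
/- Let (Ψ_k) be a sequence of functions holomorphic on the domain D = {z ∈ ℂⁿ : Re z_j < 0 for all j}, with Re Ψ_k(z) ≤ 0 on D for all k, such that the restrictions ψ_k = Ψ_k|_{(−∞,0)ⁿ} converge pointwise on (−∞,0)ⁿ to a function ψ. Then (Ψ_k) converges uniformly on compact subsets of D to a holomorphic function Ψ on D whose restriction to (−∞,0)ⁿ is ψ. -/
open MeasureTheory Filter Set

noncomputable section

/-- The domain `{z ∈ ℂⁿ : Re z_j < 0 for all j}`. -/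
def leftDomain (n : ℕ) : Set (Fin n → ℂ) := {z | ∀ j, (z j).re < 0}

theorem isOpen_leftDomain (n : ℕ) : IsOpen (leftDomain n) := by
  have : leftDomain n = ⋂ j, {z | (z j).re < 0} := by ext; simp [leftDomain]
  rw [this]
  exact isOpen_iInter_of_finite fun j => isOpen_lt (by fun_prop) continuous_const

theorem convex_leftDomain (n : ℕ) : Convex ℝ (leftDomain n) := by
  intro x hx y hy a b ha hb hab j
  have h1 := hx j
  have h2 := hy j
  simp only [Pi.add_apply, Pi.smul_apply, Complex.add_re, Complex.real_smul,
    Complex.re_ofReal_mul]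
  rcases ha.eq_or_lt with rfl | ha
  · simp_all
  · nlinarith [mul_neg_of_pos_of_neg ha h1, mul_nonneg hb (neg_nonneg.2 h2.le)]

/-- The balls of radius `R` around `(-R, …, -R)` lie in the domain. -/
theorem ball_subset_leftDomain (n : ℕ) {R : ℝ} (hR : 0 < R) :
    Metric.ball (fun _ => ((-R : ℝ) : ℂ)) R ⊆ leftDomain n := by
  intro z hz j
  rw [Metric.mem_ball, dist_pi_lt_iff hR] at hz
  have h := (Complex.re_le_norm _).trans_lt (dist_eq_norm (z j) _ ▸ hz j)
  simp only [Complex.sub_re, Complex.ofReal_re] at h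
  linarith

/-- The balls of radius `R` around `(-R, …, -R)` exhaust the domain. -/
theorem exists_mem_ball_of_mem_leftDomain {n : ℕ} {z : Fin n → ℂ} (hz : z ∈ leftDomain n) :
    ∃ R > 0, z ∈ Metric.ball (fun _ : Fin n => ((-R : ℝ) : ℂ)) R := by
  have key (j : Fin n) : ∀ᶠ R : ℝ in atTop, dist (z j) ((-R : ℝ) : ℂ) < R := by
    filter_upwards [eventually_gt_atTop 0,
      eventually_gt_atTop (Complex.normSq (z j) / (-2 * (z j).re))] with R hR hR'
    have hj : 0 < -2 * (z j).re := by linarith [hz j]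
    rw [div_lt_iff₀ hj, Complex.normSq_apply] at hR'
    rw [dist_eq_norm, ← sq_lt_sq₀ (norm_nonneg _) hR.le, Complex.sq_norm, Complex.normSq_apply]
    simp only [Complex.sub_re, Complex.sub_im, Complex.ofReal_re, Complex.ofReal_im]
    nlinarith
  obtain ⟨R, h, hR⟩ := ((eventually_all.2 key).and (eventually_gt_atTop 0)).exists
  exact ⟨R, hR, (dist_pi_lt_iff hR).2 h⟩

section NormedSpace

variable {E : Type*} [NormedAddCommGroup E] [NormedSpace ℂ E]

/-- Borel–Carathéodory bound on a ball of a complex normed space. -/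
theorem norm_le_of_re_nonpos_on_ball {f : E → ℂ} {c z : E} {R r : ℝ}
    (hf : DifferentiableOn ℂ f (Metric.ball c R)) (hre : ∀ w ∈ Metric.ball c R, (f w).re ≤ 0)
    (hr : 0 < r) (hrR : r < R) (hz : z ∈ Metric.ball c r) :
    ‖f z‖ ≤ 2 / (R / r - 1) + ‖f c‖ * (R / r + 1) / (R / r - 1) := by
  have hmaps : MapsTo (fun t : ℂ => c + t • (z - c)) (Metric.ball 0 (R / r))
      (Metric.ball c R) := by
    intro t ht
    rw [mem_ball_zero_iff] at ht
    rw [mem_ball_iff_norm] at hz ⊢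
    rw [add_sub_cancel_left, norm_smul]
    calc ‖t‖ * ‖z - c‖ ≤ ‖t‖ * r := by gcongr
      _ < R / r * r := by gcongr
      _ = R := by field_simp
  have h1 : 1 < R / r := (one_lt_div hr).2 hrR
  have h := Complex.borelCaratheodory (M := 1) (z := 1) one_pos
    (hf.comp (f := fun t : ℂ => c + t • (z - c)) (by fun_prop) hmaps)
    (fun t ht => (hre _ (hmaps ht)).trans zero_le_one) (by linarith) (by simpa using h1)
  simpa using h

/-- A locally uniformly bounded family of holomorphic functions is equicontinuous. -/
theorem equicontinuousOn_of_locally_bounded {ι : Type*} {F : ι → E → ℂ} {U : Set E}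
    (hU : IsOpen U) (hF : ∀ i, DifferentiableOn ℂ (F i) U)
    (hb : ∀ x ∈ U, ∃ M : ℝ, ∀ᶠ w in nhds x, ∀ i, ‖F i w‖ ≤ M) : EquicontinuousOn F U := by
  intro x hx
  refine EquicontinuousAt.equicontinuousWithinAt ?_ _
  obtain ⟨M, hM⟩ := hb x hx
  obtain ⟨ρ, hρ, hball⟩ := Metric.eventually_nhds_iff_ball.1 (hM.and (hU.mem_nhds hx))
  have hlim : Tendsto (fun w => (M + M) / ρ * dist w x) (nhds x) (nhds 0) := by
    have : Continuous fun w => (M + M) / ρ * dist w x := by fun_prop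
    simpa using this.tendsto x
  refine Metric.equicontinuousAt_of_continuity_modulus _ hlim _ ?_
  filter_upwards [Metric.ball_mem_nhds x hρ] with w hw i
  rw [dist_comm]
  refine Complex.dist_le_div_mul_dist_of_mapsTo_ball
    ((hF i).mono fun y hy => (hball y hy).2) (fun y hy => ?_) hw
  rw [mem_closedBall_iff_norm]
  exact (norm_sub_le _ _).trans
    (add_le_add ((hball y hy).1 i) ((hball x (Metric.mem_ball_self hρ)).1 i))

/-- A locally uniform limit of holomorphic functions on a locally compact complex normed space is
holomorphic. -/
theorem differentiableOn_of_tendstoLocallyUniformlyOn [LocallyCompactSpace E] {ι : Type*} {l : Filter ι} [l.NeBot]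
    {F : ι → E → ℂ} {f : E → ℂ} {U : Set E} (hU : IsOpen U)
    (hF : ∀ i, DifferentiableOn ℂ (F i) U) (hlim : TendstoLocallyUniformlyOn F f l U) :
    DifferentiableOn ℂ f U := by
  intro x hx
  obtain ⟨t, ht, hunif⟩ : ∃ t ∈ nhds x, TendstoUniformlyOn F f l t := by
    obtain ⟨t, ht, htU, htc⟩ := local_compact_nhds (hU.mem_nhds hx)
    exact ⟨t, ht, (tendstoLocallyUniformlyOn_iff_forall_isCompact hU).1 hlim t htU htc⟩
  obtain ⟨ρ, hρ, hball⟩ :=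
    Metric.eventually_nhds_iff_ball.1 ((eventually_mem_set.2 ht).and (hU.mem_nhds hx))
  have hcauchy : UniformCauchySeqOn (fun i => fderiv ℂ (F i)) l (Metric.ball x (ρ / 2)) := by
    intro u hu
    obtain ⟨ε, hε, hεu⟩ := Metric.mem_uniformity_dist.1 hu
    have hδ : 0 < ε * (ρ / 2) / 4 := by positivity
    filter_upwards [hunif.uniformCauchySeqOn _ (Metric.dist_mem_uniformity hδ)] with m hm y hy
    apply hεu
    have hsub : Metric.ball y (ρ / 2) ⊆ Metric.ball x ρ :=
      Metric.ball_subset_ball' (by linarith [Metric.mem_ball.1 hy])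
    have hyU (w) (hw : w ∈ Metric.ball y (ρ / 2)) : w ∈ U := (hball w (hsub hw)).2
    have hd (i : ι) : DifferentiableOn ℂ (F i) (Metric.ball y (ρ / 2)) := (hF i).mono hyU
    have hd' (i : ι) : DifferentiableAt ℂ (F i) y :=
      (hd i).differentiableAt (Metric.ball_mem_nhds y (by positivity))
    rw [dist_eq_norm, ← fderiv_sub (hd' _) (hd' _)]
    have hm' (w) (hw : w ∈ Metric.ball y (ρ / 2)) :
        ‖(F m.1 - F m.2) w‖ < ε * (ρ / 2) / 4 := by
      simpa [dist_eq_norm] using hm w (hball w (hsub hw)).1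
    refine (Complex.norm_fderiv_le_div_of_mapsTo_ball (R₁ := ρ / 2) (R₂ := ε * (ρ / 2) / 2)
      ((hd m.1).sub (hd m.2)) (fun w hw => ?_) (by positivity)).trans_lt ?_
    · rw [mem_closedBall_iff_norm]
      refine (norm_sub_le _ _).trans ?_
      linarith [hm' w hw, hm' y (Metric.mem_ball_self (by positivity))]
    · rw [div_lt_iff₀ (by positivity)]
      nlinarith [mul_pos hε hρ]
  have hlim' : ∀ y, ∃ a, y ∈ Metric.ball x (ρ / 2) →
      Tendsto (fun i => fderiv ℂ (F i) y) l (nhds a) := by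
    intro y
    by_cases hy : y ∈ Metric.ball x (ρ / 2)
    · obtain ⟨a, ha⟩ := CompleteSpace.complete (hcauchy.cauchy_map hy)
      exact ⟨a, fun _ => ha⟩
    · exact ⟨0, fun h => absurd h hy⟩
  choose f' hf' using hlim'
  have hsub : Metric.ball x (ρ / 2) ⊆ Metric.ball x ρ :=
    Metric.ball_subset_ball (by linarith)
  exact (hasFDerivAt_of_tendstoUniformlyOn Metric.isOpen_ball
    (hcauchy.tendstoUniformlyOn_of_tendsto hf')
    (fun i y hy => ((hF i).differentiableAt
      (hU.mem_nhds (hball y (hsub hy)).2)).hasFDerivAt)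
    (fun y hy => hunif.tendsto_at (hball y (hsub hy)).1)
    (Metric.mem_ball_self (by positivity))).differentiableAt.differentiableWithinAt

end NormedSpace

/-- The identity theorem from the real orthant. -/
theorem eqOn_leftDomain_of_eqOn_negOrthant {n : ℕ} {f g : (Fin n → ℂ) → ℂ}
    (hf : DifferentiableOn ℂ f (leftDomain n)) (hg : DifferentiableOn ℂ g (leftDomain n))
    (h : ∀ s ∈ negOrthant n, f (fun i => (s i : ℂ)) = g (fun i => (s i : ℂ))) :
    EqOn f g (leftDomain n) := by
  intro z hz
  let L : ℂ → Fin n → ℂ := fun w i => ((z i).re : ℂ) + w * ((z i).im : ℂ)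
  have hL : Differentiable ℂ L := by fun_prop
  let W : Set ℂ := L ⁻¹' leftDomain n
  have hWo : IsOpen W := (isOpen_leftDomain n).preimage hL.continuous
  have hWc : Convex ℝ W := by
    intro a ha b hb s t hs ht hst
    have : L (s • a + t • b) = s • L a + t • L b := by
      ext i
      simp only [L, Pi.add_apply, Pi.smul_apply, Complex.real_smul]
      have : (s : ℂ) + t = 1 := by exact_mod_cast hst
      linear_combination (-((z i).re : ℂ)) * this
    simpa only [W, mem_preimage, this] using convex_leftDomain n ha hb hs ht hst
  have hW0 : (0 : ℂ) ∈ W := fun j => by simpa [L] using hz j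
  have hLI : L Complex.I = z := by
    ext i
    simp only [L]
    rw [mul_comm, Complex.re_add_im]
  have hWI : Complex.I ∈ W := by simpa only [W, mem_preimage, hLI] using hz
  have hreal (t : ℝ) (ht : (t : ℂ) ∈ W) : f (L t) = g (L t) := by
    have := h (fun i => (z i).re + t * (z i).im) (fun i => by simpa [L] using ht i)
    simpa [L] using this
  have hfreq : ∃ᶠ w in nhdsWithin (0 : ℂ) {0}ᶜ, (f ∘ L) w = (g ∘ L) w := by
    have hten : Tendsto (fun t : ℝ => (t : ℂ)) (nhdsWithin 0 {0}ᶜ) (nhdsWithin 0 {0}ᶜ) :=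
      tendsto_nhdsWithin_of_tendsto_nhds_of_eventually_within _
        ((Complex.continuous_ofReal.tendsto' 0 0 Complex.ofReal_zero).mono_left
          nhdsWithin_le_nhds)
        (by filter_upwards [self_mem_nhdsWithin] with t ht; simpa using ht)
    refine hten.frequently (Eventually.frequently ?_)
    filter_upwards [(hten.mono_right nhdsWithin_le_nhds).eventually (hWo.mem_nhds hW0)] with t ht
    exact hreal t ht
  have := ((hf.comp hL.differentiableOn fun _ h => h).analyticOnNhd
    hWo).eqOn_of_preconnected_of_frequently_eq
    ((hg.comp hL.differentiableOn fun _ h => h).analyticOnNhd hWo) hWc.isPreconnected hW0 hfreq hWI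
  simpa [hLI] using this

/-- Montel-type convergence: if `Ψ_k` are holomorphic on
`D = {z ∈ ℂⁿ : Re z_j < 0}` with `Re Ψ_k ≤ 0` on `D`, and their restrictions to
`(−∞,0)ⁿ` converge pointwise to `ψ`, then `Ψ_k` converges uniformly on compact
subsets of `D` to a holomorphic function `Ψ` extending `ψ`. -/
theorem montel_convergence (n : ℕ) (Ψk : ℕ → (Fin n → ℂ) → ℂ)
    (hol : ∀ k, DifferentiableOn ℂ (Ψk k) {z : Fin n → ℂ | ∀ j, (z j).re < 0})
    (hre : ∀ k, ∀ z : Fin n → ℂ, (∀ j, (z j).re < 0) → (Ψk k z).re ≤ 0)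
    (ψ : (Fin n → ℝ) → ℝ)
    (hconv : ∀ s ∈ negOrthant n,
      Tendsto (fun k => Ψk k (fun i => (s i : ℂ))) atTop (nhds ((ψ s : ℂ)))) :
    ∃ Ψ : (Fin n → ℂ) → ℂ,
      DifferentiableOn ℂ Ψ {z : Fin n → ℂ | ∀ j, (z j).re < 0} ∧
      (∀ K : Set (Fin n → ℂ), IsCompact K →
        K ⊆ {z : Fin n → ℂ | ∀ j, (z j).re < 0} →
        TendstoUniformlyOn Ψk Ψ atTop K) ∧
      ∀ s ∈ negOrthant n, Ψ (fun i => (s i : ℂ)) = (ψ s : ℂ) := by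
  have hD := isOpen_leftDomain n
  have hbound : ∀ z ∈ leftDomain n, ∃ M : ℝ, ∀ᶠ w in nhds z, ∀ k, ‖Ψk k w‖ ≤ M := by
    intro z hz
    obtain ⟨R, hR, hzR⟩ := exists_mem_ball_of_mem_leftDomain hz
    obtain ⟨r, hzr, hrR⟩ := exists_between (Metric.mem_ball.1 hzR)
    have hr : 0 < r := dist_nonneg.trans_lt hzr
    obtain ⟨C, hC⟩ := (hconv (fun _ => -R) fun _ => neg_lt_zero.2 hR).norm.bddAbove_range
    have h1 : 1 < R / r := (one_lt_div hr).2 hrR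
    refine ⟨2 / (R / r - 1) + C * (R / r + 1) / (R / r - 1), ?_⟩
    filter_upwards [Metric.isOpen_ball.mem_nhds (Metric.mem_ball.2 hzr)] with w hw k
    refine (norm_le_of_re_nonpos_on_ball ((hol k).mono (ball_subset_leftDomain n hR))
      (fun y hy => hre k y (ball_subset_leftDomain n hR hy)) hr hrR hw).trans ?_
    have hCk := hC ⟨k, rfl⟩
    have : 0 ≤ R / r - 1 := by linarith
    gcongr
  have hequi := equicontinuousOn_of_locally_bounded hD hol hbound
  have hascoli (l : Filter ℕ) (g : (Fin n → ℂ) → ℂ)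
      (hg : ∀ z ∈ leftDomain n, Tendsto (fun k => Ψk k z) l (nhds (g z)))
      (K : Set (Fin n → ℂ)) (hK : IsCompact K) (hKD : K ⊆ leftDomain n) :
      TendstoUniformlyOn Ψk g l K := by
    have h := (EquicontinuousOn.tendsto_uniformOnFun_iff_pi' (𝔖 := {K}) (F := Ψk) (by simpa)
      (by simpa using hequi.mono hKD) l g).2
      (tendsto_pi_nhds.2 fun x => hg _ (hKD (by simpa using x.2)))
    exact UniformOnFun.tendsto_iff_tendstoUniformlyOn.1 h K rfl
  have hdiff (l : Filter ℕ) [l.NeBot] (g : (Fin n → ℂ) → ℂ)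
      (hg : ∀ z ∈ leftDomain n, Tendsto (fun k => Ψk k z) l (nhds (g z))) :
      DifferentiableOn ℂ g (leftDomain n) :=
    differentiableOn_of_tendstoLocallyUniformlyOn hD hol
      ((tendstoLocallyUniformlyOn_iff_forall_isCompact hD).2
        fun K hKD hK => hascoli l g hg K hK hKD)
  have hultra (l : Ultrafilter ℕ) : ∃ g : (Fin n → ℂ) → ℂ,
      ∀ z ∈ leftDomain n, Tendsto (fun k => Ψk k z) l (nhds (g z)) := by
    have (z : Fin n → ℂ) : ∃ a, z ∈ leftDomain n → Tendsto (fun k => Ψk k z) l (nhds a) := by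
      by_cases hz : z ∈ leftDomain n
      · obtain ⟨M, hM⟩ := hbound z hz
        obtain ⟨a, -, ha⟩ := (isCompact_closedBall (0 : ℂ) M).ultrafilter_le_nhds
          (l.map fun k => Ψk k z) (by
            rw [le_principal_iff]
            exact mem_map.2 (Filter.mem_of_superset univ_mem fun k _ => by
              simpa using hM.self_of_nhds k))
        exact ⟨a, fun _ => ha⟩
      · exact ⟨0, fun h => absurd h hz⟩
    choose g hg using this
    exact ⟨g, hg⟩
  choose G hG using hultra
  have hGψ (l : Ultrafilter ℕ) (hl : (l : Filter ℕ) ≤ atTop) (s) (hs : s ∈ negOrthant n) :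
      G l (fun i => (s i : ℂ)) = ψ s :=
    tendsto_nhds_unique (hG l _ fun i => by simpa using hs i) ((hconv s hs).mono_left hl)
  let l₀ : Ultrafilter ℕ := Ultrafilter.of atTop
  have hl₀ : (l₀ : Filter ℕ) ≤ atTop := Ultrafilter.of_le _
  have hlim : ∀ z ∈ leftDomain n, Tendsto (fun k => Ψk k z) atTop (nhds (G l₀ z)) := by
    intro z hz
    rw [tendsto_iff_ultrafilter]
    intro l hl
    rw [eqOn_leftDomain_of_eqOn_negOrthant (hdiff l₀ _ (hG l₀)) (hdiff l _ (hG l))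
      (fun s hs => (hGψ l₀ hl₀ s hs).trans (hGψ l hl s hs).symm) hz]
    exact hG l z hz
  exact ⟨G l₀, hdiff atTop _ hlim, hascoli atTop _ hlim, hGψ l₀ hl₀⟩
end
end

section
/- Let f : ℝ → [0,∞) be a nonnegative nondecreasing function with f(r) = 0 for r < 0, and define w(t) = ∫₀^∞ e^{rt} f(r) dr for t < 0 (assumed finite), so that w(−p) is the Laplace transform of f. Let ψ ∈ T_1 satisfy ψ′(−∞) := lim_{t→−∞} ψ′(t) = 0, and suppose the integral φ(s) = ∫_s^0 ψ(t) w(t) dt exists for all s < 0. Then φ belongs to T_1. -/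
open MeasureTheory Filter Set

noncomputable section

/-- `f` is absolutely monotone on `(-∞,0)`: it is `C^∞` there and all of its
derivatives (of all orders, including order `0`) are nonnegative there. -/
def AbsMono1 (f : ℝ → ℝ) : Prop :=
  ContDiffOn ℝ (⊤ : ℕ∞) f (Set.Iio 0) ∧
  ∀ (k : ℕ), ∀ x < (0:ℝ), 0 ≤ iteratedDerivWithin k f (Set.Iio 0) x

/-- `ψ` belongs to the class `T_1`: it is a nonpositive `C^∞` function on `(-∞,0)`
whose derivative is absolutely monotone, i.e. all derivatives of order `≥ 1`
are nonnegative on `(-∞,0)`. -/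
def MemT1 (ψ : ℝ → ℝ) : Prop :=
  ContDiffOn ℝ (⊤ : ℕ∞) ψ (Set.Iio 0) ∧ (∀ x < (0:ℝ), ψ x ≤ 0) ∧
  ∀ (k : ℕ), ∀ x < (0:ℝ), 0 ≤ iteratedDerivWithin (k + 1) ψ (Set.Iio 0) x

/-- The derivatives of a product with the identity function. -/
theorem iteratedDerivWithin_id_mul {h : ℝ → ℝ} {s : Set ℝ} (hs : UniqueDiffOn ℝ s)
    (hh : ContDiffOn ℝ (⊤ : ℕ∞) h s) (k : ℕ) :
    ∀ x ∈ s, iteratedDerivWithin k (fun t => t * h t) s x =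
      x * iteratedDerivWithin k h s x + k * iteratedDerivWithin (k - 1) h s x := by
  induction k with
  | zero => intro x _; simp
  | succ k ih =>
    intro x hx
    have hd (n : ℕ) : HasDerivWithinAt (iteratedDerivWithin n h s)
        (iteratedDerivWithin (n + 1) h s x) s x := by
      rw [iteratedDerivWithin_succ]
      exact ((hh.differentiableOn_iteratedDerivWithin (m := n)
        (by exact_mod_cast ENat.natCast_lt_top n) hs) x hx).hasDerivWithinAt
    rw [iteratedDerivWithin_succ, derivWithin_congr ih (ih x hx)]
    have h1 := ((hasDerivWithinAt_id x s).mul (hd k)).add ((hd (k - 1)).const_mul (k : ℝ))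
    refine (h1.derivWithin (hs x hx)).trans ?_
    rcases k with _ | k
    · simp; ring
    · simp; ring

theorem AbsMono1.mul {f g : ℝ → ℝ} (hf : AbsMono1 f) (hg : AbsMono1 g) : AbsMono1 (f * g) := by
  refine ⟨hf.1.mul hg.1, fun k x hx => ?_⟩
  rw [iteratedDerivWithin_mul (mem_Iio.2 hx) isOpen_Iio.uniqueDiffOn
    ((hf.1 x hx).of_le (mod_cast le_top)) ((hg.1 x hx).of_le (mod_cast le_top))]
  exact Finset.sum_nonneg fun i _ =>
    mul_nonneg (mul_nonneg (Nat.cast_nonneg _) (hf.2 i x hx)) (hg.2 _ x hx)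

theorem AbsMono1.congr {f g : ℝ → ℝ} (hf : AbsMono1 f) (h : EqOn g f (Iio 0)) : AbsMono1 g :=
  ⟨hf.1.congr h, fun k x hx => (iteratedDerivWithin_congr h hx).symm ▸ hf.2 k x hx⟩

/-- The Taylor polynomials of a function in `T_1` are nonpositive at `0`. -/
theorem MemT1.taylor_sum_nonpos {ψ : ℝ → ℝ} (hψ : MemT1 ψ) (n : ℕ) {t : ℝ} (ht : t < 0) :
    ∑ k ∈ Finset.range (n + 1),
      ((k.factorial : ℝ)⁻¹ * (-t) ^ k) * iteratedDerivWithin k ψ (Iio 0) t ≤ 0 := by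
  have hsmooth {x : ℝ} (hx : x < 0) : ContDiffAt ℝ (⊤ : ℕ∞) ψ x :=
    (hψ.1 x hx).contDiffAt (Iio_mem_nhds hx)
  have key : ∀ s ∈ Ioo t 0, ∑ k ∈ Finset.range (n + 1),
      ((k.factorial : ℝ)⁻¹ * (s - t) ^ k) * iteratedDerivWithin k ψ (Iio 0) t ≤ 0 := by
    rintro s ⟨hts, hs⟩
    have hsub : uIcc t s ⊆ Iio 0 := fun x hx => by
      rw [uIcc_of_le hts.le] at hx
      exact hx.2.trans_lt hs
    obtain ⟨y, hy, hyeq⟩ := taylor_mean_remainder_lagrange_iteratedDeriv (n := n) hts.ne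
      ((hψ.1.mono hsub).of_le (mod_cast le_top))
    rw [uIoo_of_le hts.le] at hy
    have hy0 : y < 0 := hy.2.trans hs
    have hd := hψ.2.2 n y hy0
    rw [iteratedDerivWithin_of_isOpen isOpen_Iio hy0] at hd
    have hpos : 0 ≤ ψ s - taylorWithinEval ψ n (uIcc t s) t s := by
      rw [hyeq]
      have := sub_pos.2 hts
      positivity
    rw [taylor_within_apply] at hpos
    have hsum : ∑ k ∈ Finset.range (n + 1),
        ((k.factorial : ℝ)⁻¹ * (s - t) ^ k) • iteratedDerivWithin k ψ (uIcc t s) t =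
        ∑ k ∈ Finset.range (n + 1),
        ((k.factorial : ℝ)⁻¹ * (s - t) ^ k) * iteratedDerivWithin k ψ (Iio 0) t := by
      refine Finset.sum_congr rfl fun k _ => ?_
      rw [smul_eq_mul, iteratedDerivWithin_of_isOpen isOpen_Iio ht,
        iteratedDerivWithin_eq_iteratedDeriv (uniqueDiffOn_uIcc hts.ne)
          ((hsmooth ht).of_le (mod_cast le_top)) left_mem_uIcc]
    rw [hsum] at hpos
    linarith [hψ.2.1 s hs]
  have hlim : Tendsto (fun s => ∑ k ∈ Finset.range (n + 1),
      ((k.factorial : ℝ)⁻¹ * (s - t) ^ k) * iteratedDerivWithin k ψ (Iio 0) t)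
      (nhdsWithin 0 (Iio 0)) (nhds (∑ k ∈ Finset.range (n + 1),
      ((k.factorial : ℝ)⁻¹ * (0 - t) ^ k) * iteratedDerivWithin k ψ (Iio 0) t)) :=
    Continuous.continuousWithinAt (by fun_prop)
  rw [zero_sub] at hlim
  exact le_of_tendsto hlim (by filter_upwards [Ioo_mem_nhdsLT ht] with s hs using key s hs)

theorem MemT1.absMono1_inv_mul {ψ : ℝ → ℝ} (hψ : MemT1 ψ) : AbsMono1 (fun t => t⁻¹ * ψ t) := by
  have hsm : ContDiffOn ℝ (⊤ : ℕ∞) (fun t => t⁻¹ * ψ t) (Iio 0) :=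
    (contDiffOn_id.inv fun x hx => ne_of_lt hx).mul hψ.1
  refine ⟨hsm, fun k x hx => ?_⟩
  have hrec (k : ℕ) : iteratedDerivWithin k ψ (Iio 0) x =
      x * iteratedDerivWithin k (fun t => t⁻¹ * ψ t) (Iio 0) x +
        k * iteratedDerivWithin (k - 1) (fun t => t⁻¹ * ψ t) (Iio 0) x := by
    rw [← iteratedDerivWithin_id_mul isOpen_Iio.uniqueDiffOn hsm k x hx]
    refine iteratedDerivWithin_congr (fun t ht => ?_) hx
    exact (mul_inv_cancel_left₀ (ne_of_lt ht) _).symm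
  have hformula (k : ℕ) : (-x) ^ (k + 1) *
      iteratedDerivWithin k (fun t => t⁻¹ * ψ t) (Iio 0) x =
      -(k.factorial * ∑ j ∈ Finset.range (k + 1),
        ((j.factorial : ℝ)⁻¹ * (-x) ^ j) * iteratedDerivWithin j ψ (Iio 0) x) := by
    induction k with
    | zero => simp [mul_inv_cancel_left₀ hx.ne]
    | succ k ih =>
      have h := hrec (k + 1)
      rw [Finset.sum_range_succ, mul_add, neg_add, Nat.factorial_succ, Nat.cast_mul, mul_assoc,
        ← mul_neg, ← ih, h]
      have : (k.factorial : ℝ) ≠ 0 := by positivity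
      push_cast
      field_simp
      ring
  have hx' : 0 < (-x) ^ (k + 1) := pow_pos (neg_pos.2 hx) _
  refine nonneg_of_mul_nonneg_right ?_ hx'
  rw [hformula k, neg_nonneg]
  exact mul_nonpos_of_nonneg_of_nonpos (Nat.cast_nonneg _) (hψ.taylor_sum_nonpos k hx)

/-- The derivative of `r ↦ r ^ k * exp (x * r)`. -/
theorem hasDerivAt_pow_mul_exp (k : ℕ) (x r : ℝ) :
    HasDerivAt (fun r => r ^ k * Real.exp (x * r))
      (x * (r ^ k * Real.exp (x * r)) + k * (r ^ (k - 1) * Real.exp (x * r))) r := by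
  have h := (hasDerivAt_pow k r).mul ((hasDerivAt_id r).const_mul x).exp
  refine h.congr_deriv ?_
  simp
  ring

theorem integral_Ici_deriv_pow_mul_exp_nonpos (k : ℕ) {x : ℝ} (hx : x < 0)
    (hint : IntegrableOn (fun r => x * (r ^ k * Real.exp (x * r)) +
      k * (r ^ (k - 1) * Real.exp (x * r))) (Ici 0)) :
    ∫ r in Ici (0 : ℝ), (x * (r ^ k * Real.exp (x * r)) +
      k * (r ^ (k - 1) * Real.exp (x * r))) ≤ 0 := by
  have hlim : Tendsto (fun r : ℝ => r ^ k * Real.exp (x * r)) atTop (nhds 0) := by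
    have h := tendsto_rpow_mul_exp_neg_mul_atTop_nhds_zero (k : ℝ) (-x) (neg_pos.2 hx)
    simpa using h
  rw [integral_Ici_eq_integral_Ioi, integral_Ioi_of_hasDerivAt_of_tendsto'
    (fun r _ => hasDerivAt_pow_mul_exp k x r) (hint.mono_set Ioi_subset_Ici_self) hlim,
    zero_sub, neg_nonpos]
  positivity

/-- Integrating a monotone function against a kernel that changes sign from positive to
negative at `k / (-x)`. -/
theorem deriv_pow_mul_exp_mul_le {f : ℝ → ℝ} (hf : Monotone f) (k : ℕ) {x r : ℝ} (hx : x < 0)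
    (hr : 0 ≤ r) :
    (x * (r ^ k * Real.exp (x * r)) + k * (r ^ (k - 1) * Real.exp (x * r))) * f r ≤
    (x * (r ^ k * Real.exp (x * r)) + k * (r ^ (k - 1) * Real.exp (x * r))) *
      f (k / (-x)) := by
  have hx' : 0 < -x := neg_pos.2 hx
  rcases k with _ | k
  · have h0 : f 0 ≤ f r := hf hr
    have := Real.exp_pos (x * r)
    simp only [pow_zero, Nat.cast_zero, zero_mul, add_zero, zero_div, one_mul]
    exact mul_le_mul_of_nonpos_left h0 (mul_nonpos_of_nonpos_of_nonneg hx.le this.le)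
  · have hfac : x * (r ^ (k + 1) * Real.exp (x * r)) +
        (k + 1 : ℕ) * (r ^ (k + 1 - 1) * Real.exp (x * r)) =
        (r ^ k * Real.exp (x * r)) * (x * r + (k + 1 : ℕ)) := by
      rw [Nat.add_sub_cancel]; ring
    have hp : 0 ≤ r ^ k * Real.exp (x * r) := by positivity
    rw [hfac]
    rcases le_total r ((k + 1 : ℕ) / (-x)) with h | h
    · refine mul_le_mul_of_nonneg_left (hf h) (mul_nonneg hp ?_)
      rw [le_div_iff₀ hx'] at h
      linarith
    · refine mul_le_mul_of_nonpos_left (hf h) (mul_nonpos_of_nonneg_of_nonpos hp ?_)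
      rw [div_le_iff₀ hx'] at h
      linarith

theorem mem_interior_integrableExpSet_of_neg {μ : Measure ℝ}
    (h : ∀ t < (0 : ℝ), Integrable (fun r => Real.exp (t * r)) μ) {t : ℝ} (ht : t < 0) :
    t ∈ interior (ProbabilityTheory.integrableExpSet id μ) :=
  mem_interior.2 ⟨Iio 0, fun _ hs => h _ hs, isOpen_Iio, ht⟩

/-- If `w` is the Laplace transform of a monotone nonnegative function, then `-t * w t` is
absolutely monotone. -/
theorem absMono1_neg_mul_laplace {f w : ℝ → ℝ} (hf0 : ∀ r, 0 ≤ f r) (hf : Monotone f)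
    (hw : ∀ t < (0 : ℝ), w t = ∫ r in Ici (0 : ℝ), Real.exp (r * t) * f r)
    (hwint : ∀ t < (0 : ℝ),
      IntegrableOn (fun r => Real.exp (r * t) * f r) (Ici (0 : ℝ))) :
    ContDiffOn ℝ (⊤ : ℕ∞) w (Iio 0) ∧ AbsMono1 (fun t => -(t * w t)) := by
  set F : ℝ → NNReal := fun r => (f r).toNNReal
  have hFm : Measurable F := hf.measurable.real_toNNReal
  have hFf (r : ℝ) : (F r : ℝ) = f r := Real.coe_toNNReal _ (hf0 r)
  set μ : Measure ℝ := (volume.restrict (Ici (0 : ℝ))).withDensity fun r => F r with hμ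
  have hμint (g : ℝ → ℝ) : Integrable g μ ↔ IntegrableOn (fun r => g r * f r) (Ici 0) := by
    rw [hμ, integrable_withDensity_iff_integrable_smul hFm]
    simp only [NNReal.smul_def, hFf, smul_eq_mul, mul_comm, IntegrableOn]
  have hμeq (g : ℝ → ℝ) : ∫ r, g r ∂μ = ∫ r in Ici (0 : ℝ), g r * f r := by
    rw [hμ, integral_withDensity_eq_integral_smul hFm]
    simp only [NNReal.smul_def, hFf, smul_eq_mul, mul_comm]
  have hμmem {t : ℝ} (ht : t < 0) : t ∈ interior (ProbabilityTheory.integrableExpSet id μ) :=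
    mem_interior_integrableExpSet_of_neg (fun s hs => by
      rw [hμint]; simpa only [mul_comm s] using hwint s hs) ht
  have hvmem {t : ℝ} (ht : t < 0) : t ∈ interior
      (ProbabilityTheory.integrableExpSet id (volume.restrict (Ici (0 : ℝ)))) :=
    mem_interior_integrableExpSet_of_neg (fun s hs => by
      have := integrableOn_exp_mul_Ioi hs 0
      rwa [← integrableOn_Ici_iff_integrableOn_Ioi] at this) ht
  have hwmgf : EqOn w (ProbabilityTheory.mgf id μ) (Iio 0) := fun t ht => by
    rw [hw t ht, ProbabilityTheory.mgf, hμeq]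
    simp only [id, mul_comm t]
  have hwsm : ContDiffOn ℝ (⊤ : ℕ∞) w (Iio 0) := by
    refine ContDiffOn.congr (fun t ht => ?_) hwmgf
    exact (ProbabilityTheory.analyticAt_mgf (hμmem ht)).contDiffAt.contDiffWithinAt
  refine ⟨hwsm, (contDiffOn_id.mul hwsm).neg, fun k x hx => ?_⟩
  have hwk (n : ℕ) : iteratedDerivWithin n w (Iio 0) x = ∫ r, r ^ n * Real.exp (x * r) ∂μ := by
    rw [iteratedDerivWithin_congr hwmgf hx, iteratedDerivWithin_of_isOpen isOpen_Iio hx,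
      ProbabilityTheory.iteratedDeriv_mgf (hμmem hx)]
    rfl
  have hiμ (n : ℕ) : Integrable (fun r => r ^ n * Real.exp (x * r)) μ :=
    ProbabilityTheory.integrable_pow_mul_exp_of_mem_interior_integrableExpSet (hμmem hx) n
  have hiv (n : ℕ) : IntegrableOn (fun r : ℝ => r ^ n * Real.exp (x * r)) (Ici 0) :=
    ProbabilityTheory.integrable_pow_mul_exp_of_mem_interior_integrableExpSet (hvmem hx) n
  have hgμ := ((hiμ k).const_mul x).add ((hiμ (k - 1)).const_mul (k : ℝ))
  have hgv := ((hiv k).const_mul x).add ((hiv (k - 1)).const_mul (k : ℝ))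
  rw [iteratedDerivWithin_fun_neg, iteratedDerivWithin_id_mul isOpen_Iio.uniqueDiffOn hwsm k x hx,
    hwk, hwk, ← integral_const_mul, ← integral_const_mul,
    ← integral_add ((hiμ k).const_mul x) ((hiμ (k - 1)).const_mul (k : ℝ)), hμeq, neg_nonneg]
  refine (setIntegral_mono_on ((hμint _).1 hgμ) (hgv.mul_const (f (k / (-x))))
    measurableSet_Ici fun r hr => deriv_pow_mul_exp_mul_le hf k hx hr).trans ?_
  refine (integral_mul_const (f (k / (-x))) _).trans_le ?_
  exact mul_nonpos_of_nonpos_of_nonneg (integral_Ici_deriv_pow_mul_exp_nonpos k hx hgv) (hf0 _)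

/-- Differentiation of `s ↦ ∫ t in (s, 0), g t`. -/
theorem hasDerivAt_integral_Ioo_left {g φ : ℝ → ℝ} (hg : ContinuousOn g (Iio 0))
    (hφ : ∀ s < (0 : ℝ), φ s = ∫ t in Ioo s 0, g t)
    (hint : ∀ s < (0 : ℝ), IntegrableOn g (Ioo s 0)) {s : ℝ} (hs : s < 0) :
    HasDerivAt φ (-g s) s := by
  have hmem : Iio (0 : ℝ) ∈ nhds s := Iio_mem_nhds hs
  have hi : IntervalIntegrable g volume s 0 :=
    (intervalIntegrable_iff_integrableOn_Ioo_of_le hs.le).2 (hint s hs)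
  refine (intervalIntegral.integral_hasDerivAt_left hi
    (hg.stronglyMeasurableAtFilter isOpen_Iio s hs) (hg.continuousAt hmem)).congr_of_eventuallyEq ?_
  filter_upwards [hmem] with u hu
  rw [hφ u hu, intervalIntegral.integral_of_le (le_of_lt hu), integral_Ioc_eq_integral_Ioo]

/-- Theorem 4: if `w(−p)` is the Laplace transform of a
nonnegative nondecreasing original `f` (vanishing on `(−∞,0)`), `ψ ∈ T_1` with
`ψ′(−∞) = 0`, and the integral `φ(s) = ∫_s^0 ψ(t) w(t) dt` exists for all
`s < 0`, then `φ ∈ T_1`. -/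
theorem memT1_weighted_integral (f : ℝ → ℝ) (hf0 : ∀ r, 0 ≤ f r)
    (hfmono : Monotone f) (hfneg : ∀ r < (0:ℝ), f r = 0)
    (w : ℝ → ℝ)
    (hw : ∀ t < (0:ℝ), w t = ∫ r in Set.Ici (0:ℝ), Real.exp (r * t) * f r)
    (hwint : ∀ t < (0:ℝ),
      IntegrableOn (fun r => Real.exp (r * t) * f r) (Set.Ici (0:ℝ)))
    (ψ : ℝ → ℝ) (hψ : MemT1 ψ)
    (hlim : Tendsto (fun t => derivWithin ψ (Set.Iio 0) t) atBot (nhds 0))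
    (φ : ℝ → ℝ)
    (hφ : ∀ s < (0:ℝ), φ s = ∫ t in Set.Ioo s 0, ψ t * w t)
    (hφint : ∀ s < (0:ℝ), IntegrableOn (fun t => ψ t * w t) (Set.Ioo s 0)) :
    MemT1 φ := by
  obtain ⟨hwsm, htw⟩ := absMono1_neg_mul_laplace hf0 hfmono hw hwint
  have hw0 : ∀ t < (0 : ℝ), 0 ≤ w t := fun t ht => by
    rw [hw t ht]
    exact integral_nonneg fun r => mul_nonneg (Real.exp_pos _).le (hf0 r)
  have hderiv {s : ℝ} (hs : s < 0) : HasDerivAt φ (-(ψ s * w s)) s :=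
    hasDerivAt_integral_Ioo_left (hψ.1.continuousOn.mul hwsm.continuousOn) hφ hφint hs
  have hdw : AbsMono1 (derivWithin φ (Iio 0)) := by
    refine (hψ.absMono1_inv_mul.mul htw).congr fun t (ht : t < 0) => ?_
    rw [(hderiv ht).hasDerivWithinAt.derivWithin (isOpen_Iio.uniqueDiffWithinAt ht), Pi.mul_apply]
    have := ht.ne
    field_simp
  refine ⟨(contDiffOn_infty_iff_derivWithin isOpen_Iio.uniqueDiffOn).2
    ⟨fun s hs => (hderiv hs).differentiableAt.differentiableWithinAt, hdw.1⟩, fun s hs => ?_,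
    fun k x hx => ?_⟩
  · rw [hφ s hs]
    exact setIntegral_nonpos measurableSet_Ioo fun t ht =>
      mul_nonpos_of_nonpos_of_nonneg (hψ.2.1 t ht.2) (hw0 t ht.2)
  · rw [iteratedDerivWithin_succ']
    exact hdw.2 k x hx
end
end
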